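/- arXiv:2602.11840 — 3 statements merged into one kernel-verified Lean document; each statement's English description precedes it below -/
import Mathlib

section
/- There exists a constant C > 0 such that for every integer n ≥ 1 there is a simple graph U on n vertices with at most (19/(6·ln 3))·n·ln n + C·n edges that contains every tree on n vertices as a subgraph (up to isomorphism). Consequently, s(n) ≤ (19/(6·ln 3))·n·ln n + O(n). -/
/-- `U` contains a copy of `H` as a subgraph (up to isomorphism):
there is an injective map preserving adjacency. -/
def Contains {α β : Type} (U : SimpleGraph α) (H : SimpleGraph β) : Prop :=
  ∃ f : β → α, Function.Injective f ∧ ∀ u v : β, H.Adj u v → U.Adj (f u) (f v)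

namespace TreeUniv

variable {V : Type} [DecidableEq V]

/-- `X` is a union of connected components of the subgraph of `T` induced by `W`. -/
def Cl (T : SimpleGraph V) (W X : Finset V) : Prop :=
  X ⊆ W ∧ ∀ u ∈ X, ∀ v ∈ W, T.Adj u v → v ∈ X

/-- `W` is partitioned into `X`, `Y`, `Z` without edges between distinct parts. -/
structure Sep (T : SimpleGraph V) (W X Y Z : Finset V) : Prop where
  un : X ∪ Y ∪ Z = W
  dXY : Disjoint X Y
  dXZ : Disjoint X Z
  dYZ : Disjoint Y Z
  nXY : ∀ u ∈ X, ∀ v ∈ Y, ¬ T.Adj u v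
  nXZ : ∀ u ∈ X, ∀ v ∈ Z, ¬ T.Adj u v
  nYZ : ∀ u ∈ Y, ∀ v ∈ Z, ¬ T.Adj u v

lemma Sep.swap12 {T : SimpleGraph V} {W X Y Z : Finset V} (h : Sep T W X Y Z) :
    Sep T W Y X Z :=
  ⟨by rw [Finset.union_comm Y X]; exact h.un, h.dXY.symm, h.dYZ, h.dXZ,
    fun u hu v hv a => h.nXY v hv u hu a.symm, h.nYZ, h.nXZ⟩

lemma Sep.swap23 {T : SimpleGraph V} {W X Y Z : Finset V} (h : Sep T W X Y Z) :
    Sep T W X Z Y :=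
  ⟨by rw [Finset.union_assoc, Finset.union_comm Z Y, ← Finset.union_assoc]; exact h.un,
    h.dXZ, h.dXY, h.dYZ.symm, h.nXZ, h.nXY,
    fun u hu v hv a => h.nYZ v hv u hu a.symm⟩

lemma Sep.card {T : SimpleGraph V} {W X Y Z : Finset V} (h : Sep T W X Y Z) :
    X.card + Y.card + Z.card = W.card := by
  rw [← h.un, Finset.card_union_of_disjoint, Finset.card_union_of_disjoint h.dXY]
  exact Finset.disjoint_union_left.2 ⟨h.dXZ, h.dYZ⟩

/-- In a forest, a component of `W` avoiding `c` contains at most one neighbour of `c`. -/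
lemma nbr_unique (T : SimpleGraph V) (hT : T.IsAcyclic) (W D : Finset V) (c : V) (hc : c ∉ W)
    (hD : Cl T W D) (hmin : ∀ X, X.Nonempty → X ⊆ D → Cl T W X → X = D)
    (d e : V) (hd : d ∈ D) (he : e ∈ D) (hcd : T.Adj c d) (hce : T.Adj c e) : d = e := by
  classical
  by_contra hne
  have hb := (SimpleGraph.isAcyclic_iff_forall_adj_isBridge.1 hT) hcd
  rw [SimpleGraph.isBridge_iff] at hb
  set T' := T \ SimpleGraph.fromEdgeSet {s(c, d)} with hT'
  have hadj : ∀ u v, T.Adj u v → s(u, v) ≠ s(c, d) → T'.Adj u v := by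
    intro u v h1 h2
    simp only [hT', SimpleGraph.sdiff_adj, SimpleGraph.fromEdgeSet_adj, Set.mem_singleton_iff]
    exact ⟨h1, fun h => h2 h.1⟩
  have hX := hmin (D.filter (fun v => T'.Reachable d v))
    ⟨d, by simp [hd]⟩ (Finset.filter_subset _ _) ⟨(Finset.filter_subset _ _).trans hD.1, by
      intro u hu v hv huv
      rw [Finset.mem_filter] at hu ⊢
      refine ⟨hD.2 u hu.1 v hv huv, hu.2.trans (SimpleGraph.Adj.reachable (hadj u v huv ?_))⟩
      intro h
      have : c ∈ s(u, v) := by rw [h]; simp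
      rw [Sym2.mem_iff] at this
      rcases this with rfl | rfl
      · exact hc (hD.1 hu.1)
      · exact hc hv⟩
  rw [← hX, Finset.mem_filter] at he
  apply hb
  refine (he.2.trans (SimpleGraph.Adj.reachable (hadj e c hce.symm ?_))).symm
  intro h
  rw [Sym2.eq_iff] at h
  rcases h with ⟨h1, -⟩ | ⟨h1, -⟩
  · exact hce.ne h1.symm
  · exact hne h1.symm

lemma three (T : SimpleGraph V) (hT : T.IsAcyclic) (S : Finset V) (l r : ℕ)
    (hS : S.card = l + r + 1) :
    ∃ c ∈ S, ∃ X Y Z, Sep T (S.erase c) X Y Z ∧ X.card ≤ l ∧ Y.card ≤ l ∧ Z.card ≤ r := by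
  classical
  have hex : ∃ k, ∃ c ∈ S, ∃ Y, Cl T (S.erase c) Y ∧ l ≤ Y.card ∧ Y.card = k := by
    obtain ⟨c, hc⟩ : S.Nonempty := by rw [← Finset.card_pos]; omega
    refine ⟨_, c, hc, S.erase c, ⟨subset_rfl, fun _ _ v hv _ => hv⟩, ?_, rfl⟩
    rw [Finset.card_erase_of_mem hc]; omega
  obtain ⟨c, hc, Y, hY, hlY, hk⟩ := Nat.find_spec hex
  have hminY : ∀ c' ∈ S, ∀ Y', Cl T (S.erase c') Y' → l ≤ Y'.card → Y.card ≤ Y'.card := by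
    intro c' hc' Y' h1 h2
    rw [hk]
    exact Nat.find_min' hex ⟨c', hc', Y', h1, h2, rfl⟩
  set W := S.erase c with hW
  have hWc : W.card = l + r := by rw [hW, Finset.card_erase_of_mem hc]; omega
  have hcW : c ∉ W := by simp [hW]
  -- small components
  have hsmall : ∀ Z, Z.Nonempty → Z ⊆ Y → Cl T W Z →
      ∃ D, D.Nonempty ∧ D ⊆ Z ∧ Cl T W D ∧ D.card ≤ l := by
    intro Z hZ hZY hZcl
    obtain ⟨D, hDm, hDmin⟩ := Finset.exists_min_image
      (Z.powerset.filter (fun X => X.Nonempty ∧ Cl T W X)) Finset.card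
      ⟨Z, by simp [hZ, hZcl]⟩
    simp only [Finset.mem_filter, Finset.mem_powerset] at hDm hDmin
    obtain ⟨hDZ, hDne, hDcl⟩ := hDm
    refine ⟨D, hDne, hDZ, hDcl, ?_⟩
    by_contra hlt
    push Not at hlt
    have hmin : ∀ X, X.Nonempty → X ⊆ D → Cl T W X → X = D := fun X h1 h2 h3 =>
      Finset.eq_of_subset_of_card_le h2 (hDmin X ⟨h2.trans hDZ, h1, h3⟩)
    obtain ⟨d, hd, hdu⟩ : ∃ d ∈ D, ∀ e ∈ D, T.Adj c e → e = d := by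
      by_cases h : ∃ d ∈ D, T.Adj c d
      · obtain ⟨d, hd, hcd⟩ := h
        exact ⟨d, hd, fun e he hce =>
          nbr_unique T hT W D c hcW hDcl hmin e d he hd hce hcd⟩
      · push Not at h
        obtain ⟨d, hd⟩ := hDne
        exact ⟨d, hd, fun e he hce => absurd hce (h e he)⟩
    have hdS : d ∈ S := Finset.mem_of_mem_erase (hDcl.1 hd)
    have := hminY d hdS (D.erase d) ⟨by
        intro v hv
        rw [Finset.mem_erase] at hv ⊢
        exact ⟨hv.1, Finset.mem_of_mem_erase (hDcl.1 hv.2)⟩, by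
        intro u hu v hv huv
        rw [Finset.mem_erase] at hu hv ⊢
        refine ⟨hv.1, ?_⟩
        by_cases hvc : v = c
        · subst hvc
          exact absurd (hdu u hu.2 huv.symm) hu.1
        · exact hDcl.2 u hu.2 v (by rw [hW, Finset.mem_erase]; exact ⟨hvc, hv.2⟩) huv⟩
      (by rw [Finset.card_erase_of_mem hd]; omega)
    rw [Finset.card_erase_of_mem hd] at this
    have h2 := Finset.card_le_card (hDZ.trans hZY)
    omega
  -- maximal R
  have hcompl : ∀ X, Cl T W X → Cl T W (W \ X) := by
    intro X hX
    refine ⟨Finset.sdiff_subset, ?_⟩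
    intro u hu v hv huv
    rw [Finset.mem_sdiff] at hu ⊢
    exact ⟨hv, fun h => hu.2 (hX.2 v h u hu.1 huv.symm)⟩
  obtain ⟨R, hRm, hRmax⟩ := Finset.exists_max_image
      (W.powerset.filter (fun X => Cl T W X ∧ W \ Y ⊆ X ∧ X.card ≤ r)) Finset.card
      ⟨W \ Y, by
        simp only [Finset.mem_filter, Finset.mem_powerset]
        refine ⟨Finset.sdiff_subset, hcompl Y hY, subset_rfl, ?_⟩
        rw [Finset.card_sdiff_of_subset hY.1]; omega⟩
  simp only [Finset.mem_filter, Finset.mem_powerset] at hRm hRmax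
  obtain ⟨hRW, hRcl, hYR, hRr⟩ := hRm
  have hZcl := hcompl R hRcl
  set Z := W \ R with hZ
  have hZc : Z.card + R.card = l + r := by
    rw [← hWc, hZ]; exact Finset.card_sdiff_add_card_eq_card hRW
  have hZY : Z ⊆ Y := by
    intro v hv
    rw [hZ, Finset.mem_sdiff] at hv
    by_contra h
    exact hv.2 (hYR (Finset.mem_sdiff.2 ⟨hv.1, h⟩))
  have hZR : Disjoint Z R := Finset.sdiff_disjoint
  have hnZR : ∀ u ∈ Z, ∀ v ∈ R, ¬ T.Adj u v := fun u hu v hv h =>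
    (Finset.disjoint_left.1 hZR) (hZcl.2 u hu v (hRW hv) h) hv
  have hun : Z ∪ R = W := Finset.sdiff_union_of_subset hRW
  by_cases hZe : Z.card ≤ l
  · refine ⟨c, hc, Z, ∅, R, ⟨by simpa using hun, by simp, hZR, by simp, by simp, hnZR, by simp⟩,
      hZe, by simp, hRr⟩
  · push Not at hZe
    obtain ⟨D, hDne, hDZ, hDcl, hDl⟩ := hsmall Z (by rw [← Finset.card_pos]; omega) hZY hZcl
    have hDR : Disjoint D R := Finset.disjoint_of_subset_left hDZ hZR
    have hbig : r < R.card + D.card := by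
      by_contra h
      push Not at h
      have hcu : (R ∪ D).card = R.card + D.card := Finset.card_union_of_disjoint hDR.symm
      have := hRmax (R ∪ D) ⟨Finset.union_subset hRW hDcl.1,
        ⟨Finset.union_subset hRW hDcl.1, by
          intro u hu v hv huv
          rw [Finset.mem_union] at hu ⊢
          rcases hu with hu | hu
          · exact Or.inl (hRcl.2 u hu v hv huv)
          · exact Or.inr (hDcl.2 u hu v hv huv)⟩,
        hYR.trans Finset.subset_union_left, by omega⟩
      have := Finset.card_pos.2 hDne
      omega
    refine ⟨c, hc, D, Z \ D, R, ⟨?_, Finset.disjoint_sdiff, hDR,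
      Finset.disjoint_of_subset_left Finset.sdiff_subset hZR, ?_, ?_, ?_⟩, hDl, ?_, hRr⟩
    · rw [Finset.union_sdiff_of_subset hDZ]; exact hun
    · intro u hu v hv h
      rw [Finset.mem_sdiff] at hv
      exact hv.2 (hDcl.2 u hu v (hZcl.1 hv.1) h)
    · intro u hu v hv; exact hnZR u (hDZ hu) v hv
    · intro u hu v hv; exact hnZR u (Finset.sdiff_subset hu) v hv
    · rw [Finset.card_sdiff_of_subset hDZ]; omega

lemma cut_aux (T : SimpleGraph V) (hT : T.IsAcyclic) (S : Finset V) (l r : ℕ) (hlr : l ≤ r)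
    (hS : S.card = l + r + 1) :
    ∃ c ∈ S, ∃ L M R, Sep T (S.erase c) L M R ∧ L.card ≤ l ∧ R.card ≤ r ∧
      M.card ≤ L.card ∧ M.card ≤ R.card := by
  obtain ⟨c, hc, X, Y, Z, h, hX, hY, hZ⟩ := three T hT S l r hS
  refine ⟨c, hc, ?_⟩
  rcases le_total X.card Y.card with h1 | h1 <;> rcases le_total Y.card Z.card with h2 | h2 <;>
    rcases le_total X.card Z.card with h3 | h3
  · exact ⟨Y, X, Z, h.swap12, by omega, by omega, by omega, by omega⟩
  · exact ⟨Y, X, Z, h.swap12, by omega, by omega, by omega, by omega⟩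
  · exact ⟨Z, X, Y, h.swap23.swap12, by omega, by omega, by omega, by omega⟩
  · exact ⟨X, Z, Y, h.swap23, by omega, by omega, by omega, by omega⟩
  · exact ⟨X, Y, Z, h, by omega, by omega, by omega, by omega⟩
  · exact ⟨Z, Y, X, h.swap12.swap23.swap12, by omega, by omega, by omega, by omega⟩
  · exact ⟨Y, Z, X, h.swap12.swap23, by omega, by omega, by omega, by omega⟩
  · exact ⟨Y, Z, X, h.swap12.swap23, by omega, by omega, by omega, by omega⟩

/-- The cutting lemma. -/
lemma cut (T : SimpleGraph V) (hT : T.IsAcyclic) (S : Finset V) (l r : ℕ)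
    (hS : S.card = l + r + 1) :
    ∃ c ∈ S, ∃ L M R, Sep T (S.erase c) L M R ∧ ∃ l' r', L.card + l' = l ∧ R.card + r' = r ∧
      M.card = l' + r' ∧ 2 * l' + r' ≤ l ∧ l' + 2 * r' ≤ r := by
  have key : ∃ c ∈ S, ∃ L M R, Sep T (S.erase c) L M R ∧ L.card ≤ l ∧ R.card ≤ r ∧
      M.card ≤ L.card ∧ M.card ≤ R.card := by
    rcases le_total l r with h | h
    · exact cut_aux T hT S l r h hS
    · obtain ⟨c, hc, L, M, R, h1, h2, h3, h4, h5⟩ := cut_aux T hT S r l h (by omega)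
      exact ⟨c, hc, R, M, L, h1.swap12.swap23.swap12, h3, h2, h5, h4⟩
  obtain ⟨c, hc, L, M, R, h1, h2, h3, h4, h5⟩ := key
  have hcard := h1.card
  rw [Finset.card_erase_of_mem hc] at hcard
  exact ⟨c, hc, L, M, R, h1, l - L.card, r - R.card, by omega, by omega, by omega, by omega,
    by omega⟩

/-- `T[S]` embeds into the positions `P` of the host relation `H`. -/
def Emb (T : SimpleGraph V) (H : ℕ → ℕ → Prop) (S : Finset V) (P : Set ℕ) : Prop :=
  ∃ f : V → ℕ, (∀ u ∈ S, ∀ v ∈ S, f u = f v → u = v) ∧ (∀ u ∈ S, f u ∈ P) ∧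
    ∀ u ∈ S, ∀ v ∈ S, T.Adj u v → H (f u) (f v)

lemma Emb.mono {T : SimpleGraph V} {H : ℕ → ℕ → Prop} {S : Finset V} {P Q : Set ℕ}
    (h : Emb T H S P) (hPQ : P ⊆ Q) : Emb T H S Q := by
  obtain ⟨f, h1, h2, h3⟩ := h
  exact ⟨f, h1, fun u hu => hPQ (h2 u hu), h3⟩

lemma Emb.union {T : SimpleGraph V} {H : ℕ → ℕ → Prop} {X Y : Finset V} {P Q : Set ℕ}
    (hX : Emb T H X P) (hY : Emb T H Y Q) (hPQ : ∀ x ∈ P, x ∉ Q)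
    (hn : ∀ u ∈ X, ∀ v ∈ Y, ¬ T.Adj u v) : Emb T H (X ∪ Y) (P ∪ Q) := by
  obtain ⟨f, f1, f2, f3⟩ := hX
  obtain ⟨g, g1, g2, g3⟩ := hY
  have hXX : ∀ u, u ∈ X ∪ Y → u ∉ X → u ∈ Y := by
    intro u hu h; rcases Finset.mem_union.1 hu with h' | h'
    · exact absurd h' h
    · exact h'
  refine ⟨fun v => if v ∈ X then f v else g v, ?_, ?_, ?_⟩
  · intro u hu v hv h
    by_cases h1 : u ∈ X <;> by_cases h2 : v ∈ X <;> simp only [h1, h2, if_true, if_false] at h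
    · exact f1 u h1 v h2 h
    · exact absurd (h ▸ g2 v (hXX v hv h2)) (hPQ _ (f2 u h1))
    · exact absurd (h ▸ g2 u (hXX u hu h1)) (hPQ _ (f2 v h2))
    · exact g1 u (hXX u hu h1) v (hXX v hv h2) h
  · intro u hu
    by_cases h1 : u ∈ X <;> simp only [h1, if_true, if_false]
    · exact Or.inl (f2 u h1)
    · exact Or.inr (g2 u (hXX u hu h1))
  · intro u hu v hv h
    by_cases h1 : u ∈ X <;> by_cases h2 : v ∈ X <;> simp only [h1, h2, if_true, if_false]
    · exact f3 u h1 v h2 h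
    · exact absurd h (hn u h1 v (hXX v hv h2))
    · exact absurd h.symm (hn v h2 u (hXX u hu h1))
    · exact g3 u (hXX u hu h1) v (hXX v hv h2) h

lemma Emb.insert {T : SimpleGraph V} {H : ℕ → ℕ → Prop} (hH : ∀ x y, H x y → H y x)
    {W : Finset V} {P : Set ℕ} (hW : Emb T H W P) (c : V) (x : ℕ) (hx : x ∉ P)
    (hadj : ∀ y ∈ P, H x y) : Emb T H (insert c W) (insert x P) := by
  obtain ⟨f, f1, f2, f3⟩ := hW
  have hXX : ∀ u, u ∈ Insert.insert c W → u ≠ c → u ∈ W := by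
    intro u hu h; exact Finset.mem_of_mem_insert_of_ne hu h
  refine ⟨fun v => if v = c then x else f v, ?_, ?_, ?_⟩
  · intro u hu v hv h
    by_cases h1 : u = c <;> by_cases h2 : v = c <;> simp only [h1, h2, if_true, if_false] at h
    · rw [h1, h2]
    · exact absurd (h ▸ f2 v (hXX v hv h2)) hx
    · exact absurd (h ▸ f2 u (hXX u hu h1)) hx
    · exact f1 u (hXX u hu h1) v (hXX v hv h2) h
  · intro u hu
    by_cases h1 : u = c <;> simp only [h1, if_true, if_false]
    · exact Or.inl rfl
    · exact Or.inr (f2 u (hXX u hu h1))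
  · intro u hu v hv h
    by_cases h1 : u = c <;> by_cases h2 : v = c <;> simp only [h1, h2, if_true, if_false]
    · exact absurd (h1.trans h2.symm) h.ne
    · exact hadj _ (f2 v (hXX v hv h2))
    · exact hH _ _ (hadj _ (f2 u (hXX u hu h1)))
    · exact f3 u (hXX u hu h1) v (hXX v hv h2) h

/-- One cutting step. -/
lemma step (T : SimpleGraph V) (hT : T.IsAcyclic) (H : ℕ → ℕ → Prop)
    (hH : ∀ x y, H x y → H y x) (S : Finset V) (a l x r : ℕ) (hx : a + l ≤ x)
    (hS : S.card = l + r + 1)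
    (hadj : ∀ y, ((a ≤ y ∧ y < a + l) ∨ (x < y ∧ y < x + 1 + r)) → H x y)
    (hon : ∀ (X : Finset V) (b : ℕ), X.card < S.card → a ≤ b → b + X.card ≤ x + 1 + r →
      Emb T H X {y | b ≤ y ∧ y < b + X.card})
    (hmid : ∀ (X : Finset V) (l' r' : ℕ), X.card = l' + r' → l' ≤ l → r' ≤ r →
      2 * l' + r' ≤ l → l' + 2 * r' ≤ r → 
      Emb T H X {y | (a + l - l' ≤ y ∧ y < a + l) ∨ (x + 1 ≤ y ∧ y < x + 1 + r')}) :
    Emb T H S {y | (a ≤ y ∧ y < a + l) ∨ (x ≤ y ∧ y < x + 1 + r)} := by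
  obtain ⟨c, hc, L, M, R, hsep, l', r', h1, h2, h3, h4, h5⟩ := cut T hT S l r hS
  have eL := hon L a (by omega) le_rfl (by omega)
  have eR := hon R (x + 1 + r') (by omega) (by omega) (by omega)
  have eM := hmid M l' r' h3 (by omega) (by omega) h4 h5
  have e1 := eL.union eM (by
    intro y hy hy'
    simp only [Set.mem_ofPred_eq] at hy hy'
    omega) hsep.nXY
  have e2 := e1.union eR (by
    intro y hy hy'
    simp only [Set.mem_union, Set.mem_ofPred_eq] at hy hy'
    omega) (by
    intro u hu v hv
    rcases Finset.mem_union.1 hu with h | h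
    · exact hsep.nXZ u h v hv
    · exact hsep.nYZ u h v hv)
  rw [hsep.un] at e2
  have e3 := e2.insert hH c x (by
    simp only [Set.mem_union, Set.mem_ofPred_eq]
    omega) (by
    intro y hy
    apply hadj
    simp only [Set.mem_union, Set.mem_ofPred_eq] at hy
    omega)
  rw [Finset.insert_erase hc] at e3
  apply e3.mono
  intro y hy
  simp only [Set.mem_insert_iff, Set.mem_union, Set.mem_ofPred_eq] at hy ⊢
  omega

/-- reach of the `i`-th vertex following a position of rank `j` -/
def D (j i : ℕ) : ℕ := if i = 0 then 2 ^ j else if i = 1 then 2 ^ j / 2 + 1 else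
  2 * 2 ^ j / 3 ^ i + i

/-- directed reach relation -/
def Rch (n x y : ℕ) : Prop := ∃ j t i, i ≤ j ∧ 2 ^ j * (2 * t + 1) ≤ n ∧
  x = 2 ^ j * (2 * t + 1) + i ∧ y ≤ x + D j i ∧ x ≤ y + D j i

def Hst (n x y : ℕ) : Prop := Rch n x y ∨ Rch n y x

lemma Hst.symm (n x y : ℕ) (h : Hst n x y) : Hst n y x := Or.symm h

/-- Every nonempty interval of positive integers has a point of dominating dyadic rank. -/
lemma exists_top (a N : ℕ) (ha : 1 ≤ a) (hN : 1 ≤ N) :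
    ∃ j t, a ≤ 2 ^ j * (2 * t + 1) ∧ 2 ^ j * (2 * t + 1) < a + N ∧
      2 ^ j * (2 * t) < a ∧ a + N ≤ 2 ^ j * (2 * t + 2) := by
  classical
  let P : ℕ → Prop := fun j => ∃ q, a ≤ 2 ^ j * q ∧ 2 ^ j * q < a + N
  have hP0 : P 0 := ⟨a, by simp, by simp; omega⟩
  have hb : ∀ j, P j → j ≤ a + N := by
    rintro j ⟨q, h1, h2⟩
    have hq : 1 ≤ q := by
      rcases Nat.eq_zero_or_pos q with rfl | h
      · simp at h1; omega
      · exact h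
    have := Nat.lt_two_pow_self (n := j)
    nlinarith
  obtain ⟨q, h1, h2⟩ := Nat.findGreatest_spec (P := P) (Nat.zero_le (a + N)) hP0
  set j := Nat.findGreatest P (a + N) with hj
  have hn : ¬ P (j + 1) := by
    intro h
    have := Nat.le_findGreatest (hb _ h) h
    omega
  have hne : ∀ q', ¬ (a ≤ 2 ^ j * (2 * q') ∧ 2 ^ j * (2 * q') < a + N) := by
    intro q' h
    exact hn ⟨q', by rw [pow_succ, mul_assoc]; exact h.1, by rw [pow_succ, mul_assoc]; exact h.2⟩
  rcases Nat.even_or_odd' q with ⟨t, rfl | rfl⟩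
  · exact absurd ⟨h1, h2⟩ (hne t)
  · refine ⟨j, t, h1, h2, ?_, ?_⟩
    · have := hne t
      by_contra h
      push Not at h
      exact this ⟨h, lt_of_le_of_lt (Nat.mul_le_mul_left _ (by omega)) h2⟩
    · have := hne (t + 1)
      by_contra h
      push Not at h
      exact this ⟨le_trans h1 (Nat.mul_le_mul_left _ (by omega)), by
        rw [show 2 * (t + 1) = 2 * t + 2 by ring]; exact h⟩

lemma main_emb (n : ℕ) (T : SimpleGraph V) (hT : T.IsAcyclic) :
    ∀ (N : ℕ) (S : Finset V) (a : ℕ), S.card = N → 1 ≤ a → a + N ≤ n + 1 →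
      Emb T (Hst n) S {y | a ≤ y ∧ y < a + N} := by
  intro N
  induction N using Nat.strong_induction_on with
  | _ N ih =>
  -- intervals with a hole
  have hole : ∀ (m : ℕ) (S : Finset V) (j t i l r : ℕ), S.card = m → m < N → 1 ≤ i → m = l + r →
      2 ^ j * (2 * t + 1) ≤ n → l < 2 ^ j * (2 * t + 1) →
      2 ^ j * (2 * t + 1) + i + r ≤ n + 1 →
      2 * l ≤ 2 ^ j → 2 * r ≤ 2 ^ j → 3 ^ i * (l + r) ≤ 2 * 2 ^ j →
      Emb T (Hst n) S {y | (2 ^ j * (2 * t + 1) - l ≤ y ∧ y < 2 ^ j * (2 * t + 1)) ∨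
        (2 ^ j * (2 * t + 1) + i ≤ y ∧ y < 2 ^ j * (2 * t + 1) + i + r)} := by
    intro m
    induction m using Nat.strong_induction_on with
    | _ m ihm =>
    intro S j t i l r hS hm hi hlr hpn hlp hrn hl2 hr2 h3
    generalize hp : 2 ^ j * (2 * t + 1) = p at *
    rcases Nat.eq_zero_or_pos l with rfl | hl
    · apply (ih m hm S (p + i) hS (by omega) (by omega)).mono
      intro y hy
      simp only [Set.mem_ofPred_eq] at hy ⊢
      omega
    rcases Nat.eq_zero_or_pos r with rfl | hr
    · apply (ih m hm S (p - l) hS (by omega) (by omega)).mono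
      intro y hy
      simp only [Set.mem_ofPred_eq] at hy ⊢
      omega
    obtain ⟨r, rfl⟩ : ∃ r', r = r' + 1 := ⟨r - 1, by omega⟩
    have hij : i ≤ j := by
      have h4 : 3 ^ i * 2 ≤ 3 ^ i * (l + (r + 1)) := Nat.mul_le_mul_left _ (by omega)
      have h5 : 2 ^ i ≤ 3 ^ i := Nat.pow_le_pow_left (by norm_num) i
      exact (Nat.pow_le_pow_iff_right (by norm_num : 1 < 2)).1 (by omega : 2 ^ i ≤ 2 ^ j)
    have hD : l + i ≤ D j i ∧ r ≤ D j i := by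
      unfold D
      rw [if_neg (by omega)]
      split_ifs with h
      · omega
      · have : l + (r + 1) ≤ 2 * 2 ^ j / 3 ^ i := by
          rw [Nat.le_div_iff_mul_le (by positivity)]
          rw [mul_comm]; exact h3
        omega
    have := step T hT (Hst n) (Hst.symm n) S (p - l) l (p + i) r (by omega) (by omega)
      (by
        intro y hy
        left
        refine ⟨j, t, i, hij, by omega, by omega, by omega, by omega⟩)
      (by
        intro X b h1 h2 h3
        exact ih X.card (by omega) X b rfl (by omega) (by omega))
      (by
        intro X l' r' h1 h2 h3' h4 h5
        have h6 : 3 ^ (i + 1) * (l' + r') ≤ 2 * 2 ^ j := by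
          calc 3 ^ (i + 1) * (l' + r') = 3 ^ i * (3 * (l' + r')) := by ring
            _ ≤ 3 ^ i * (l + (r + 1)) := Nat.mul_le_mul_left _ (by omega)
            _ ≤ _ := h3
        have := ihm (l' + r') (by omega) X j t (i + 1) l' r' h1 (by omega) (by omega) rfl
          (by omega) (by omega) (by omega) (by omega) (by omega) h6
        rw [hp] at this
        apply this.mono
        intro y hy
        simp only [Set.mem_ofPred_eq] at hy ⊢
        omega)
    apply this.mono
    intro y hy
    simp only [Set.mem_ofPred_eq] at hy ⊢
    omega
  intro S a hS ha haN
  rcases Nat.eq_zero_or_pos N with rfl | hN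
  · rw [Finset.card_eq_zero] at hS
    subst hS
    exact ⟨fun _ => 0, by simp, by simp, by simp⟩
  obtain ⟨j, t, h1, h2, h3, h4⟩ := exists_top a N ha hN
  have e1 : 2 ^ j * (2 * t) + 2 ^ j = 2 ^ j * (2 * t + 1) := by ring
  have e2 : 2 ^ j * (2 * t + 2) = 2 ^ j * (2 * t + 1) + 2 ^ j := by ring
  rw [e2] at h4
  generalize hp : 2 ^ j * (2 * t + 1) = p at *
  have := step T hT (Hst n) (Hst.symm n) S a (p - a) p (a + N - 1 - p) (by omega) (by omega)
    (by
      intro y hy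
      left
      refine ⟨j, t, 0, by omega, by omega, by omega, ?_, ?_⟩ <;> simp only [D, if_true] <;> omega)
    (by
      intro X b h1 h2 h3
      exact ih X.card (by omega) X b rfl (by omega) (by omega))
    (by
      intro X l' r' g1 g2 g3 g4 g5
      have := hole (l' + r') X j t 1 l' r' g1 (by omega) (by omega) rfl
        (by omega) (by omega) (by omega) (by omega) (by omega) (by omega)
      rw [hp] at this
      apply this.mono
      intro y hy
      simp only [Set.mem_ofPred_eq] at hy ⊢
      omega)
  apply this.mono
  intro y hy
  simp only [Set.mem_ofPred_eq] at hy ⊢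
  omega

/-! Edge count. -/

def ES (n : ℕ) : Finset (Sym2 ℕ) :=
  (Finset.range (Nat.log 2 n + 1)).biUnion fun j =>
    (Finset.range ((n / 2 ^ j + 1) / 2)).biUnion fun t =>
      (Finset.range (j + 1)).biUnion fun i =>
        ((Finset.Icc (2 ^ j * (2 * t + 1) + i - D j i) (2 ^ j * (2 * t + 1) + i + D j i)).erase
          (2 ^ j * (2 * t + 1) + i)).image fun y => s(2 ^ j * (2 * t + 1) + i, y)

lemma mem_ES (n x y : ℕ) (h : Rch n x y) (hxy : x ≠ y) : s(x, y) ∈ ES n := by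
  obtain ⟨j, t, i, hij, hn, hx, h1, h2⟩ := h
  have hpos : 0 < 2 ^ j := by positivity
  have hle : 2 ^ j ≤ n := le_trans (Nat.le_mul_of_pos_right _ (by omega)) hn
  have hj : j ≤ Nat.log 2 n := Nat.le_log_of_pow_le (by norm_num) hle
  have ht : 2 * t + 1 ≤ n / 2 ^ j := by
    rw [Nat.le_div_iff_mul_le hpos]
    linarith [mul_comm (2 ^ j) (2 * t + 1)]
  unfold ES
  simp only [Finset.mem_biUnion, Finset.mem_range, Finset.mem_image, Finset.mem_erase,
    Finset.mem_Icc]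
  refine ⟨j, by omega, t, by omega, i, by omega, y, ⟨by omega, by omega, by omega⟩, by rw [hx]⟩

lemma card_ES (n : ℕ) : (ES n).card ≤
    ∑ j ∈ Finset.range (Nat.log 2 n + 1), (n / 2 ^ j + 1) * ∑ i ∈ Finset.range (j + 2), D j i := by
  unfold ES
  refine Finset.card_biUnion_le.trans (Finset.sum_le_sum fun j _ => ?_)
  have h1 : ∀ t ∈ Finset.range ((n / 2 ^ j + 1) / 2),
      ((Finset.range (j + 1)).biUnion fun i =>
        ((Finset.Icc (2 ^ j * (2 * t + 1) + i - D j i) (2 ^ j * (2 * t + 1) + i + D j i)).erase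
          (2 ^ j * (2 * t + 1) + i)).image fun y => s(2 ^ j * (2 * t + 1) + i, y)).card
      ≤ 2 * ∑ i ∈ Finset.range (j + 2), D j i := by
    intro t _
    refine Finset.card_biUnion_le.trans ?_
    rw [Finset.mul_sum, Finset.sum_range_succ _ (j + 1)]
    refine le_trans (Finset.sum_le_sum fun i _ => ?_) (Nat.le_add_right _ _)
    refine Finset.card_image_le.trans ?_
    rw [Finset.card_erase_of_mem (by rw [Finset.mem_Icc]; omega), Nat.card_Icc]
    omega
  refine (Finset.card_biUnion_le_card_mul _ _ _ h1).trans ?_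
  rw [Finset.card_range, ← mul_assoc]
  exact Nat.mul_le_mul_right _ (by omega)

lemma sum_D (j k : ℕ) : ((∑ i ∈ Finset.range (k + 2), D j i : ℕ) : ℝ) ≤
    2 ^ j * (11 / 6 - (1 / 3) / 3 ^ k) + (k + 2) ^ 2 := by
  induction k with
  | zero =>
    have : ((2 ^ j / 2 : ℕ) : ℝ) ≤ ((2 ^ j : ℕ) : ℝ) / 2 := Nat.cast_div_le
    simp only [Finset.sum_range_succ, Finset.sum_range_zero, D]
    push_cast at this ⊢
    norm_num
    linarith
  | succ k ih =>
    have e : k + 1 + 2 = (k + 2) + 1 := by ring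
    rw [e, Finset.sum_range_succ]
    have hD : D j (k + 2) = 2 * 2 ^ j / 3 ^ (k + 2) + (k + 2) := by
      simp [D]
    have : ((2 * 2 ^ j / 3 ^ (k + 2) : ℕ) : ℝ) ≤ ((2 * 2 ^ j : ℕ) : ℝ) / ((3 ^ (k + 2) : ℕ) : ℝ) :=
      Nat.cast_div_le
    rw [hD]
    push_cast at this ih ⊢
    have e2 : (2 : ℝ) ^ j * (11 / 6 - (1 / 3) / 3 ^ (k + 1))
        = 2 ^ j * (11 / 6 - (1 / 3) / 3 ^ k) + 2 * 2 ^ j / 3 ^ (k + 2) := by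
      field_simp
      ring
    rw [e2]
    nlinarith

lemma sum_sq (k : ℕ) : ∑ j ∈ Finset.range k, ((j : ℝ) + 2) ^ 2 / 2 ^ j
    = 22 - (2 * (k : ℝ) ^ 2 + 12 * k + 22) / 2 ^ k := by
  induction k with
  | zero => norm_num
  | succ k ih =>
    rw [Finset.sum_range_succ, ih]
    push_cast
    field_simp
    ring

lemma card_ES_real (n : ℕ) (hn : 1 ≤ n) :
    ((ES n).card : ℝ) ≤ 19 / (6 * Real.log 3) * n * Real.log n + 50 * n := by
  have hn0 : (1 : ℝ) ≤ n := by exact_mod_cast hn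
  set J := Nat.log 2 n with hJ
  have hJn : (2 : ℝ) ^ J ≤ n := by
    exact_mod_cast Nat.pow_log_le_self 2 (by omega)
  have a1 : ((ES n).card : ℝ) ≤ ∑ j ∈ Finset.range (J + 1),
      (11 / 6 * (n : ℝ) + 11 / 6 * 2 ^ j + 2 * n * (((j : ℝ) + 2) ^ 2 / 2 ^ j)) := by
    refine le_trans (Nat.cast_le.mpr (card_ES n)) ?_
    rw [Nat.cast_sum]
    refine Finset.sum_le_sum fun j hj => ?_
    rw [Nat.cast_mul]
    have hjJ : j ≤ J := by have := Finset.mem_range.mp hj; omega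
    have hp : (0 : ℝ) < 2 ^ j := by positivity
    have hjn : (2 : ℝ) ^ j ≤ n := le_trans (pow_le_pow_right₀ (by norm_num) hjJ) hJn
    have b1 : ((n / 2 ^ j + 1 : ℕ) : ℝ) ≤ (n : ℝ) / 2 ^ j + 1 := by
      have : ((n / 2 ^ j : ℕ) : ℝ) ≤ (n : ℝ) / ((2 ^ j : ℕ) : ℝ) := Nat.cast_div_le
      push_cast at this ⊢
      linarith
    have b2 : ((∑ i ∈ Finset.range (j + 2), D j i : ℕ) : ℝ) ≤ 11 / 6 * 2 ^ j + ((j : ℝ) + 2) ^ 2 := by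
      refine (sum_D j j).trans ?_
      have : (0 : ℝ) ≤ 2 ^ j * ((1 / 3) / 3 ^ j) := by positivity
      nlinarith
    have b3 : (1 : ℝ) ≤ n / 2 ^ j := by rwa [le_div_iff₀ hp, one_mul]
    have b4 : (n : ℝ) / 2 ^ j * 2 ^ j = n := by field_simp
    calc _ ≤ ((n : ℝ) / 2 ^ j + 1) * (11 / 6 * 2 ^ j + ((j : ℝ) + 2) ^ 2) :=
          mul_le_mul b1 b2 (Nat.cast_nonneg _) (by positivity)
      _ = 11 / 6 * ((n : ℝ) / 2 ^ j * 2 ^ j) + 11 / 6 * 2 ^ j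
          + ((n : ℝ) / 2 ^ j + 1) * ((j : ℝ) + 2) ^ 2 := by ring
      _ ≤ 11 / 6 * ((n : ℝ) / 2 ^ j * 2 ^ j) + 11 / 6 * 2 ^ j
          + ((n : ℝ) / 2 ^ j + n / 2 ^ j) * ((j : ℝ) + 2) ^ 2 := by gcongr
      _ = _ := by rw [b4]; ring
  rw [Finset.sum_add_distrib, Finset.sum_add_distrib, ← Finset.mul_sum, ← Finset.mul_sum, ← Finset.mul_sum,
    sum_sq, Finset.sum_const, Finset.card_range, geom_sum_eq (by norm_num), nsmul_eq_mul] at a1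
  have c1 : (0 : ℝ) ≤ (2 * ((J + 1 : ℕ) : ℝ) ^ 2 + 12 * ((J + 1 : ℕ) : ℝ) + 22) / 2 ^ (J + 1) := by
    positivity
  have l2 : 0 < Real.log 2 := Real.log_pos (by norm_num)
  have l3 : 0 < Real.log 3 := Real.log_pos (by norm_num)
  have ln : 0 ≤ Real.log n := Real.log_nonneg hn0
  have c2 : J * Real.log 2 ≤ Real.log n := by
    rw [← Real.log_pow]
    exact Real.log_le_log (by positivity) hJn
  have c3 : 11 * Real.log 3 ≤ 19 * Real.log 2 := by
    have := Real.log_le_log (x := (3 : ℝ) ^ 11) (y := 2 ^ 19) (by positivity) (by norm_num)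
    rw [Real.log_pow, Real.log_pow] at this
    exact_mod_cast this
  have c4 : 11 / 6 * (J : ℝ) ≤ 19 / (6 * Real.log 3) * Real.log n := by
    rw [div_mul_eq_mul_div 19, le_div_iff₀ (by positivity)]
    have hJ0 : (0 : ℝ) ≤ J := Nat.cast_nonneg _
    have := mul_le_mul_of_nonneg_left c3 hJ0
    linarith
  have c5 : 11 / 6 * (J : ℝ) * n ≤ 19 / (6 * Real.log 3) * Real.log n * n :=
    mul_le_mul_of_nonneg_right c4 (by linarith)
  have c6 := mul_nonneg (by linarith : (0 : ℝ) ≤ 2 * n) c1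
  rw [pow_succ (2 : ℝ) J] at a1 c6
  push_cast at a1 c6
  have e1 : ((2 : ℝ) ^ J * 2 - 1) / (2 - 1) = 2 ^ J * 2 - 1 := by norm_num
  rw [e1, mul_sub (2 * (n : ℝ))] at a1
  linarith

/-- The universal graph. -/
def UG (n : ℕ) : SimpleGraph (Fin n) where
  Adj v w := v ≠ w ∧ Hst n (v + 1) (w + 1)
  symm := ⟨fun _ _ h => ⟨h.1.symm, h.2.symm⟩⟩
  loopless := ⟨fun _ h => h.1 rfl⟩

lemma UG_card (n : ℕ) : (UG n).edgeSet.ncard ≤ (ES n).card := by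
  have hinj : Function.Injective (Sym2.map (fun v : Fin n => (v : ℕ) + 1)) := by
    apply Sym2.map.injective
    intro a b h
    ext
    simpa using h
  rw [← Set.ncard_image_of_injective _ hinj, ← Set.ncard_coe_finset]
  apply Set.ncard_le_ncard _ (Finset.finite_toSet _)
  rintro _ ⟨e, he, rfl⟩
  induction e using Sym2.ind with
  | _ v w =>
    rw [SimpleGraph.mem_edgeSet] at he
    obtain ⟨hne, h⟩ := he
    have hne' : (v : ℕ) + 1 ≠ w + 1 := fun h => hne (Fin.ext (by omega))
    rw [Sym2.map_mk, Finset.mem_coe]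
    rcases h with h | h
    · exact mem_ES _ _ _ h hne'
    · have := mem_ES _ _ _ h hne'.symm
      rwa [Sym2.eq_swap]

lemma UG_univ (n : ℕ) (T : SimpleGraph (Fin n)) (hT : T.IsAcyclic) : Contains (UG n) T := by
  obtain ⟨f, h1, h2, h3⟩ := main_emb n T hT n Finset.univ 1 (by simp) le_rfl (by omega)
  have h2' : ∀ v, 1 ≤ f v ∧ f v < 1 + n := fun v => h2 v (Finset.mem_univ v)
  have inj : Function.Injective fun v : Fin n => (⟨f v - 1, by have := h2' v; omega⟩ : Fin n) := by
    intro u v h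
    have := h2' u
    have := h2' v
    have := Fin.mk.inj_iff.mp h
    exact h1 u (Finset.mem_univ _) v (Finset.mem_univ _) (by omega)
  refine ⟨_, inj, fun u v h => ⟨fun e => h.ne (inj e), ?_⟩⟩
  have hu := h2' u
  have hv := h2' v
  have := h3 u (Finset.mem_univ _) v (Finset.mem_univ _) h
  simpa only [Nat.sub_add_cancel hu.1, Nat.sub_add_cancel hv.1] using this

end TreeUniv

/-- There is a constant `C > 0` such that for every `n ≥ 1` there exists a graph on `n`
vertices with at most `(19/(6 ln 3)) n ln n + C n` edges that contains every tree on `n`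
vertices as a subgraph. -/
theorem stmt_0 :
    ∃ C : ℝ, 0 < C ∧ ∀ n : ℕ, 1 ≤ n →
      ∃ U : SimpleGraph (Fin n),
        (U.edgeSet.ncard : ℝ) ≤ 19 / (6 * Real.log 3) * n * Real.log n + C * n ∧
        ∀ T : SimpleGraph (Fin n), T.IsTree → Contains U T := by
  refine ⟨50, by norm_num, fun n hn => ⟨TreeUniv.UG n, ?_, fun T hT => TreeUniv.UG_univ n T hT.isAcyclic⟩⟩
  exact (Nat.cast_le.mpr (TreeUniv.UG_card n)).trans (TreeUniv.card_ES_real n hn)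
end

section
/- There exists a constant C > 0 such that for every integer n ≥ 1 there is a simple graph U on n vertices with at most (2/ln 2)·n·ln n + C·n edges that contains every tree on n vertices as a subgraph (up to isomorphism); i.e., the universal graphs U_{n,2} built from perfect binary trees witness s(n) ≤ (2/ln 2)·n·ln n + O(n). -/
/-- Size of a perfect binary tree of height `h`. -/
def Mh : ℕ → ℕ
  | 0 => 0
  | h + 1 => 2 * Mh h + 1

/-- Edges of the universal graph on the block of height `h` starting at `p`. -/
def Ed : ℕ → ℕ → Finset (ℕ × ℕ)
  | 0, _ => ∅
  | h + 1, p =>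
    (({p} : Finset ℕ) ×ˢ Finset.Ioo p (p + Mh (h + 1))) ∪ Ed h (p + 1) ∪ Ed h (p + 1 + Mh h) ∪
      (Finset.Icc 1 h).biUnion (fun k =>
        ({p + 1 + Mh h - Mh k} : Finset ℕ) ×ˢ
          Finset.Ico (p + 1 + Mh h) (p + 1 + Mh h + (h - k) + Mh k))

lemma Mh_eq (h : ℕ) : Mh h + 1 = 2 ^ h := by
  induction h with
  | zero => simp [Mh]
  | succ k ih => rw [pow_succ, ← ih, Mh]; ring

lemma Mh_mono : Monotone Mh := monotone_nat_of_le_succ (fun n => by rw [Mh]; omega)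

lemma le_Mh (h : ℕ) : h ≤ Mh h := by
  induction h with
  | zero => simp
  | succ k ih => rw [Mh]; omega

lemma Mh_pos {k : ℕ} (hk : 1 ≤ k) : 1 ≤ Mh k := le_trans hk (le_Mh k)

lemma Mh_sub {k h : ℕ} (hk : k ≤ h) : (h - k) + Mh k ≤ Mh h := by
  induction h, hk using Nat.le_induction with
  | base => simp
  | succ n hn ih => rw [Mh]; omega

lemma Ed_bd (h : ℕ) : ∀ p a b, (a, b) ∈ Ed h p → p ≤ a ∧ a < b ∧ b < p + Mh h := by
  induction h with
  | zero => intro p a b hab; simp [Ed] at hab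
  | succ h ih =>
    intro p a b hab
    simp only [Ed, Finset.mem_union, Finset.mem_product, Finset.mem_singleton, Finset.mem_Ioo,
      Finset.mem_biUnion, Finset.mem_Icc, Finset.mem_Ico] at hab
    rw [Mh] at *
    rcases hab with ((hab | hab) | hab) | ⟨k, hk, hab⟩
    · omega
    · have := ih _ _ _ hab; omega
    · have := ih _ _ _ hab; omega
    · have h1 := Mh_mono hk.2
      have := Mh_pos hk.1
      have := Mh_sub hk.2
      omega

lemma cross_card (h p n : ℕ) :
    (((Finset.Icc 1 h).biUnion (fun k =>
        ({p - Mh k} : Finset ℕ) ×ˢ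
          Finset.Ico p (p + (h - k) + Mh k))).filter (fun e => e.2 < p + n)).card
      ≤ n + 2 ^ h + h ^ 2 := by
  rcases Nat.eq_zero_or_pos h with rfl | hh
  · simp
  rw [Finset.filter_biUnion]
  refine le_trans Finset.card_biUnion_le ?_
  have hsum : ∀ j, ∑ k ∈ Finset.Icc 1 j, (Mh k + h) ≤ 2 ^ (j + 1) + j * h := by
    intro j
    induction j with
    | zero => simp
    | succ j ih =>
      rw [Finset.sum_Icc_succ_top (by omega)]
      have := Mh_eq (j + 1)
      have h2 : 2 ^ (j + 1 + 1) = 2 * 2 ^ (j + 1) := by ring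
      rw [h2, add_mul]
      omega
  obtain ⟨j, rfl⟩ : ∃ j, h = j + 1 := ⟨h - 1, by omega⟩
  rw [Finset.sum_Icc_succ_top (by omega)]
  have h1 : ∑ k ∈ Finset.Icc 1 j, ((({p - Mh k} : Finset ℕ) ×ˢ
          Finset.Ico p (p + (j + 1 - k) + Mh k)).filter (fun e => e.2 < p + n)).card
        ≤ ∑ k ∈ Finset.Icc 1 j, (Mh k + (j + 1)) := by
    refine Finset.sum_le_sum (fun k hk => ?_)
    refine le_trans (Finset.card_filter_le _ _) ?_
    rw [Finset.card_product]
    simp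
    omega
  have h2 : ((({p - Mh (j + 1)} : Finset ℕ) ×ˢ
          Finset.Ico p (p + (j + 1 - (j + 1)) + Mh (j + 1))).filter (fun e => e.2 < p + n)).card
        ≤ n := by
    have : ((({p - Mh (j + 1)} : Finset ℕ) ×ˢ
          Finset.Ico p (p + (j + 1 - (j + 1)) + Mh (j + 1))).filter (fun e => e.2 < p + n)) ⊆
          ({p - Mh (j + 1)} : Finset ℕ) ×ˢ Finset.Ico p (p + n) := by
      intro e he
      simp only [Finset.mem_filter, Finset.mem_product, Finset.mem_Ico] at he ⊢
      exact ⟨he.1.1, he.1.2.1, he.2⟩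
    refine le_trans (Finset.card_le_card this) ?_
    rw [Finset.card_product]; simp
  have h3 := hsum j
  nlinarith

lemma Ed_card (h : ℕ) :
    (∀ p n, n ≤ Mh h → ((Ed h p).filter (fun e => e.2 < p + n)).card ≤ 2 * h * n + 3 * n) ∧
    (∀ p, ((Ed h p).filter (fun e => e.2 < p + Mh h)).card + (h ^ 2 + 2 * h + 3)
      ≤ 2 * h * Mh h + 3 * 2 ^ h) := by
  induction h with
  | zero => simp [Ed, Mh]
  | succ h ih =>
    obtain ⟨ih1, ih2⟩ := ih
    have root : ∀ p n, ((({p} : Finset ℕ) ×ˢ Finset.Ioo p (p + Mh (h + 1))).filter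
        (fun e => e.2 < p + n)).card ≤ n - 1 := by
      intro p n
      have : ((({p} : Finset ℕ) ×ˢ Finset.Ioo p (p + Mh (h + 1))).filter
        (fun e => e.2 < p + n)) ⊆ ({p} : Finset ℕ) ×ˢ Finset.Ioo p (p + n) := by
        intro e he
        simp only [Finset.mem_filter, Finset.mem_product, Finset.mem_Ioo] at he ⊢
        exact ⟨he.1.1, he.1.2.1, he.2⟩
      refine le_trans (Finset.card_le_card this) ?_
      rw [Finset.card_product]; simp
    have big : ∀ p n, Mh h + 1 < n → ((Ed (h + 1) p).filter (fun e => e.2 < p + n)).card ≤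
        (n - 1) + ((Ed h (p + 1)).filter (fun e => e.2 < (p + 1) + Mh h)).card +
        ((Ed h (p + 1 + Mh h)).filter
          (fun e => e.2 < (p + 1 + Mh h) + (n - 1 - Mh h))).card +
        ((n - 1 - Mh h) + 2 ^ h + h ^ 2) := by
      intro p n hn
      have hc := cross_card h (p + 1 + Mh h) (n - 1 - Mh h)
      have he : p + 1 + Mh h + (n - 1 - Mh h) = p + n := by omega
      rw [he] at hc ⊢
      have hE : ∀ q ∈ Ed h (p + 1), q.2 < p + 1 + Mh h := by
        rintro ⟨a, b⟩ hab
        have := Ed_bd _ _ _ _ hab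
        exact this.2.2
      rw [Ed, Finset.filter_union, Finset.filter_union, Finset.filter_union]
      refine le_trans (Finset.card_union_le _ _) (add_le_add ?_ hc)
      refine le_trans (Finset.card_union_le _ _) (add_le_add ?_ le_rfl)
      refine le_trans (Finset.card_union_le _ _) (add_le_add (root p n) ?_)
      refine Finset.card_le_card ?_
      intro q hq
      simp only [Finset.mem_filter] at hq ⊢
      exact ⟨hq.1, hE q hq.1⟩
    have hpow := Mh_eq h
    have hMs : Mh (h + 1) = 2 * Mh h + 1 := rfl
    constructor
    · intro p n hn
      by_cases hc : n ≤ Mh h + 1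
      · rcases Nat.eq_zero_or_pos n with rfl | hn0
        · rw [Finset.card_eq_zero.2]; · simp
          ext ⟨a, b⟩
          simp only [Finset.mem_filter, Finset.notMem_empty, iff_false, not_and]
          intro hab
          have := Ed_bd _ _ _ _ hab
          omega
        have hsub : (Ed (h + 1) p).filter (fun e => e.2 < p + n) ⊆
            ((({p} : Finset ℕ) ×ˢ Finset.Ioo p (p + Mh (h + 1))).filter
              (fun e => e.2 < p + n)) ∪ (Ed h (p + 1)).filter (fun e => e.2 < (p + 1) + (n - 1)) := by
          rintro ⟨a, b⟩ hab
          rw [Finset.mem_filter, Ed] at hab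
          obtain ⟨hab, hb⟩ := hab
          simp only at hb
          simp only [Finset.mem_union, Finset.mem_filter] at hab ⊢
          rcases hab with ((hab | hab) | hab) | hab
          · exact Or.inl ⟨hab, hb⟩
          · exact Or.inr ⟨hab, by omega⟩
          · have := Ed_bd _ _ _ _ hab; omega
          · simp only [Finset.mem_biUnion, Finset.mem_product, Finset.mem_Ico] at hab
            obtain ⟨k, _, hab⟩ := hab
            omega
        have h1 := Finset.card_le_card hsub
        have h2 := le_trans h1 (Finset.card_union_le _ _)
        have h3 := root p n
        have h4 := ih1 (p + 1) (n - 1) (by omega)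
        obtain ⟨n, rfl⟩ : ∃ j, n = j + 1 := ⟨n - 1, by omega⟩
        simp only [Nat.add_sub_cancel] at *
        nlinarith
      · push Not at hc
        have h1 := big p n hc
        have h2 := ih2 (p + 1)
        obtain ⟨j, rfl⟩ : ∃ j, n = Mh h + 1 + j := ⟨n - Mh h - 1, by omega⟩
        have e1 : Mh h + 1 + j - 1 - Mh h = j := by omega
        have e2 : Mh h + 1 + j - 1 = Mh h + j := by omega
        rw [e1, e2] at h1
        have h3 := ih1 (p + 1 + Mh h) j (by omega)
        nlinarith
    · intro p
      rcases Nat.eq_zero_or_pos h with rfl | hh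
      · have h1 := root p (Mh 1)
        have h2 : (Ed 1 p).filter (fun e => e.2 < p + Mh 1) =
            ((({p} : Finset ℕ) ×ˢ Finset.Ioo p (p + Mh (0 + 1))).filter
        (fun e => e.2 < p + Mh 1)) := by simp [Ed]
        have h3 : Mh 1 = 1 := rfl
        rw [zero_add, h2]
        simp only [h3] at *
        omega
      have hpos := Mh_pos hh
      have h1 := big p (Mh (h + 1)) (by omega)
      have e1 : Mh (h + 1) - 1 - Mh h = Mh h := by omega
      have e2 : Mh (h + 1) - 1 = 2 * Mh h := by omega
      rw [e1, e2] at h1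
      have h2 := ih2 (p + 1)
      have h3 := ih2 (p + 1 + Mh h)
      have e3 : 2 ^ (h + 1) = 2 * 2 ^ h := by ring
      rw [e3]
      rw [hMs] at *
      nlinarith


lemma greedy {ι : Type*} [DecidableEq ι] (w : ι → ℕ) (b T m : ℕ) (hb : b ≤ T + m) (I : Finset ι) :
    (∀ i ∈ I, w i ≤ m) → T ≤ b + ∑ i ∈ I, w i →
    ∃ J ⊆ I, T ≤ b + ∑ i ∈ J, w i ∧ b + ∑ i ∈ J, w i ≤ T + m := by
  induction I using Finset.induction_on with
  | empty => intro _ h; exact ⟨∅, by simp, by simpa using h, by simpa using hb⟩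
  | insert i I hi ih =>
    intro hw h
    by_cases hc : T ≤ b + ∑ i ∈ I, w i
    · obtain ⟨J, hJ, h1⟩ := ih (fun j hj => hw j (Finset.mem_insert_of_mem hj)) hc
      exact ⟨J, hJ.trans (Finset.subset_insert _ _), h1⟩
    · refine ⟨_, Finset.Subset.refl _, h, ?_⟩
      have := hw i (Finset.mem_insert_self _ _)
      rw [Finset.sum_insert hi] at *
      omega

lemma numeric_small {ι : Type*} [DecidableEq ι] (w : ι → ℕ) (a m : ℕ) (ha : a ≤ 2 * m)
    (I : Finset ι) (hw : ∀ i ∈ I, w i ≤ m) (hs : 2 * m ≤ a + ∑ i ∈ I, w i) :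
    ∃ J1 J2 : Finset ι, J1 ⊆ J2 ∧ J2 ⊆ I ∧ m ≤ a + ∑ i ∈ J1, w i ∧ a + ∑ i ∈ J1, w i ≤ 2 * m ∧
      2 * m ≤ a + ∑ i ∈ J2, w i ∧ a + ∑ i ∈ J2, w i ≤ 3 * m := by
  obtain ⟨J1, h1, h2, h3⟩ := greedy w a m m (by omega) I hw (by omega)
  have e := Finset.sum_sdiff h1 (f := w)
  obtain ⟨J, h4, h5, h6⟩ := greedy w (a + ∑ i ∈ J1, w i) (2 * m) m (by omega) (I \ J1)
    (fun i hi => hw i (Finset.sdiff_subset hi)) (by omega)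
  have hd : Disjoint J1 J := Finset.disjoint_of_subset_right h4 Finset.disjoint_sdiff
  refine ⟨J1, J1 ∪ J, Finset.subset_union_left,
    Finset.union_subset h1 (h4.trans Finset.sdiff_subset), h2, by omega, ?_, ?_⟩
  all_goals rw [Finset.sum_union hd]; omega

lemma numeric {ι : Type*} [DecidableEq ι] (w : ι → ℕ) (a m s N : ℕ) (hs : a + s = 2 * m)
    (I : Finset ι) (hN : a + ∑ i ∈ I, w i = N) (h1 : 2 * m + 1 ≤ N) (h2 : N ≤ 4 * m + 1)
    (i0 : ι) (hw : ∀ i ∈ I, i ≠ i0 → w i ≤ s ∧ w i + 2 * m ≤ N)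
    (h0 : w i0 ≤ s ∨ w i0 + 2 * m ≤ N) :
    ∃ J1 J2 : Finset ι, J1 ⊆ J2 ∧ J2 ⊆ I ∧ m ≤ a + ∑ i ∈ J1, w i ∧ a + ∑ i ∈ J1, w i ≤ 2 * m ∧
      2 * m ≤ a + ∑ i ∈ J2, w i ∧ a + ∑ i ∈ J2, w i ≤ 3 * m := by
  by_cases hsm : ∀ i ∈ I, w i ≤ m
  · exact numeric_small w a m (by omega) I hsm (by omega)
  -- main step, once a first big piece `c` has been chosen
  have main : ∀ c ∈ I, m < w c → w c ≤ s → (∀ d ∈ I, d ≠ c → w d + 2 * m ≤ N) →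
      ∃ J1 J2 : Finset ι, J1 ⊆ J2 ∧ J2 ⊆ I ∧ m ≤ a + ∑ i ∈ J1, w i ∧
        a + ∑ i ∈ J1, w i ≤ 2 * m ∧
        2 * m ≤ a + ∑ i ∈ J2, w i ∧ a + ∑ i ∈ J2, w i ≤ 3 * m := by
    intro c hc hcm hcs hdrop
    have ec := Finset.add_sum_erase I w hc
    -- finishing greedily inside a set `K`
    have fin : ∀ K ⊆ I.erase c, (∀ i ∈ K, w i ≤ m) → 2 * m ≤ a + w c + ∑ i ∈ K, w i →
        ∃ J1 J2 : Finset ι, J1 ⊆ J2 ∧ J2 ⊆ I ∧ m ≤ a + ∑ i ∈ J1, w i ∧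
          a + ∑ i ∈ J1, w i ≤ 2 * m ∧
          2 * m ≤ a + ∑ i ∈ J2, w i ∧ a + ∑ i ∈ J2, w i ≤ 3 * m := by
      intro K hK hKm hKs
      obtain ⟨J, h4, h5, h6⟩ := greedy w (a + w c) (2 * m) m (by omega) K hKm hKs
      have hcJ : c ∉ J := fun h => by simpa using hK (h4 h)
      refine ⟨{c}, insert c J, by simp, ?_, ?_, ?_, ?_, ?_⟩
      · exact Finset.insert_subset hc ((h4.trans hK).trans (Finset.erase_subset _ _))
      all_goals simp only [Finset.sum_singleton, Finset.sum_insert hcJ]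
      all_goals omega
    by_cases hr : ∀ i ∈ I.erase c, w i ≤ m
    · exact fin _ (Finset.Subset.refl _) hr (by omega)
    push Not at hr
    obtain ⟨d, hd, hdm⟩ := hr
    have ed := Finset.add_sum_erase (I.erase c) w hd
    have hdI := Finset.mem_of_mem_erase hd
    have hdc := Finset.ne_of_mem_erase hd
    by_cases h3 : a + w c + w d ≤ 3 * m
    · have hcd : c ∉ ({d} : Finset ι) := by simpa using hdc.symm
      refine ⟨{c}, insert c {d}, by simp, ?_, ?_, ?_, ?_, ?_⟩
      · exact Finset.insert_subset hc (by simpa using hdI)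
      all_goals simp only [Finset.sum_singleton, Finset.sum_insert hcd]
      all_goals omega
    · have hdd := hdrop d hdI hdc
      refine fin ((I.erase c).erase d) (Finset.erase_subset _ _) ?_ (by omega)
      intro i hi
      have := Finset.single_le_sum (f := w) (fun _ _ => Nat.zero_le _) hi
      omega
  by_cases hu : i0 ∈ I ∧ m < w i0 ∧ w i0 ≤ s
  · exact main i0 hu.1 hu.2.1 hu.2.2 (fun d hd hne => (hw d hd hne).2)
  have hdropall : ∀ d ∈ I, m < w d → w d + 2 * m ≤ N := by
    intro d hd hm
    by_cases hne : d = i0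
    · subst hne
      rcases h0 with h0 | h0
      · exact absurd ⟨hd, hm, h0⟩ hu
      · exact h0
    · exact (hw d hd hne).2
  by_cases hex : ∃ c ∈ I, c ≠ i0 ∧ m < w c
  · obtain ⟨c, hc, hne, hm⟩ := hex
    refine main c hc hm (hw c hc hne).1 (fun d hd hdc => ?_)
    by_cases hdm : m < w d
    · exact hdropall d hd hdm
    · have ec := Finset.add_sum_erase I w hc
      have := (hw c hc hne).1
      have := (hw c hc hne).2
      omega
  · push Not at hex hsm
    obtain ⟨c, hc, hcm⟩ := hsm
    have hci : c = i0 := by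
      by_contra hne
      have := hex c hc hne
      omega
    subst hci
    have hd := hdropall c hc hcm
    have ec := Finset.add_sum_erase I w hc
    obtain ⟨J1, J2, h3, h4, h5⟩ := numeric_small w a m (by omega) (I.erase c)
      (fun i hi => hex i (Finset.mem_of_mem_erase hi) (Finset.ne_of_mem_erase hi)) (by omega)
    exact ⟨J1, J2, h3, h4.trans (Finset.erase_subset _ _), h5⟩

/-- `S` is a union of components of the forest induced on `E`. -/
def Clo {V : Type} (par : V → V) (S E : Finset V) : Prop :=
  ∀ u ∈ S, ∀ w ∈ E, (par u = w ∨ par w = u) → w ∈ S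

section
variable {V : Type} [Fintype V] [DecidableEq V] (par : V → V) (dep : V → ℕ)

open Classical in
/-- Descendants of `x`. -/
noncomputable def sub (x : V) : Finset V := Finset.univ.filter (fun w => ∃ i : ℕ, par^[i] w = x)

lemma mem_sub (x w : V) : w ∈ sub par x ↔ ∃ i : ℕ, par^[i] w = x := by simp [sub]

lemma self_mem_sub (x : V) : x ∈ sub par x := (mem_sub par x x).2 ⟨0, rfl⟩

lemma sub_up {x w : V} (h : par w ∈ sub par x) : w ∈ sub par x := by
  rw [mem_sub] at *
  obtain ⟨i, hi⟩ := h
  exact ⟨i + 1, hi⟩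

lemma sub_down {x w : V} (h : w ∈ sub par x) (hne : w ≠ x) : par w ∈ sub par x := by
  rw [mem_sub] at *
  obtain ⟨i, hi⟩ := h
  cases i with
  | zero => exact absurd hi hne
  | succ i => exact ⟨i, hi⟩

lemma sub_child {x w : V} (h : w ∈ sub par x) (hne : w ≠ x) :
    ∃ c, par c = x ∧ c ≠ x ∧ w ∈ sub par c := by
  rw [mem_sub] at h
  obtain ⟨i, hi⟩ := h
  induction i generalizing w with
  | zero => exact absurd hi hne
  | succ i ih =>
    by_cases hp : par w = x
    · exact ⟨w, hp, hne, self_mem_sub par w⟩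
    · obtain ⟨c, h1, h2, h3⟩ := ih hp hi
      exact ⟨c, h1, h2, sub_up par h3⟩

lemma dep_iter (hdep : ∀ u, par u ≠ u → dep (par u) < dep u) (i : ℕ) (u : V) :
    dep (par^[i] u) ≤ dep u := by
  induction i generalizing u with
  | zero => simp
  | succ i ih =>
    rw [Function.iterate_succ_apply]
    refine (ih _).trans ?_
    by_cases h : par u = u
    · rw [h]
    · exact (hdep u h).le

lemma sub_disj (hdep : ∀ u, par u ≠ u → dep (par u) < dep u) {x c c' w : V}
    (hc : par c = x) (hcx : c ≠ x) (hc' : par c' = x) (hcx' : c' ≠ x)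
    (hw : w ∈ sub par c) (hw' : w ∈ sub par c') : c = c' := by
  rw [mem_sub] at hw hw'
  obtain ⟨i, hi⟩ := hw
  obtain ⟨j, hj⟩ := hw'
  have key : ∀ (i j : ℕ) (c c' : V), par c = x → c ≠ x → par c' = x → c' ≠ x → par^[i] w = c →
      par^[j] w = c' → i ≤ j → c = c' := by
    intro i j c c' hc hcx hc' hcx' hi hj hij
    obtain ⟨k, rfl⟩ := Nat.exists_eq_add_of_le hij
    rw [add_comm, Function.iterate_add_apply, hi] at hj
    cases k with
    | zero => exact hj
    | succ k =>
      rw [Function.iterate_succ_apply, hc] at hj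
      have h1 := dep_iter par dep hdep k x
      rw [hj] at h1
      have h2 := hdep c' (by rw [hc']; exact hcx'.symm)
      rw [hc'] at h2
      omega
  rcases le_total i j with h | h
  · exact key i j c c' hc hcx hc' hcx' hi hj h
  · exact (key j i c' c hc' hcx' hc hcx hj hi h).symm

lemma split (hdep : ∀ u, par u ≠ u → dep (par u) < dep u) (r : V) (hr : ∀ u, u ∈ sub par r)
    (O : Finset V) (a m : ℕ) (ha : a ≤ 2 * m) (h1 : 2 * m + 2 ≤ a + O.card)
    (h2 : a + O.card ≤ 4 * m + 2) :
    ∃ z ∈ O, ∃ X1 X2 : Finset V, X1 ⊆ X2 ∧ X2 ⊆ O.erase z ∧ Clo par X1 (O.erase z) ∧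
      Clo par X2 (O.erase z) ∧ m ≤ a + X1.card ∧ a + X1.card ≤ 2 * m ∧
      2 * m ≤ a + X2.card ∧ a + X2.card ≤ 3 * m := by
  obtain ⟨s, hs⟩ : ∃ s, a + s = 2 * m := ⟨2 * m - a, by omega⟩
  obtain ⟨t, ht⟩ : ∃ t, a + O.card = 2 * m + t := ⟨a + O.card - 2 * m, by omega⟩
  set q := min (s + 1) t with hq
  -- deepest vertex with a large subtree
  obtain ⟨x, hxm, hmax⟩ := Finset.exists_max_image
    (Finset.univ.filter (fun y => q ≤ (sub par y ∩ O).card)) dep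
    ⟨r, by
      have : sub par r ∩ O = O := Finset.inter_eq_right.2 (fun u _ => hr u)
      simp only [Finset.mem_filter, Finset.mem_univ, true_and, this]
      omega⟩
  simp only [Finset.mem_filter, Finset.mem_univ, true_and] at hxm hmax
  obtain ⟨z, hz, hzx⟩ : ∃ z ∈ O, x ∈ O → z = x := by
    by_cases hx : x ∈ O
    · exact ⟨x, hx, fun _ => rfl⟩
    · obtain ⟨z, hz⟩ : O.Nonempty := by
        rw [← Finset.card_pos]; omega
      exact ⟨z, hz, fun h => absurd h hx⟩
  let P : Option V → Finset V := fun o => match o with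
    | none => (O \ sub par x).erase z
    | some c => (sub par c ∩ O).erase z
  let I : Finset (Option V) := insert none
    ((Finset.univ.filter (fun c => par c = x ∧ c ≠ x)).map Function.Embedding.some)
  have hIsome : ∀ c, some c ∈ I ↔ par c = x ∧ c ≠ x := by intro c; simp [I]
  have hsubx : ∀ c, par c = x → ∀ w, w ∈ sub par c → w ∈ sub par x := by
    intro c hc w hw
    rw [mem_sub] at *
    obtain ⟨i, hi⟩ := hw
    exact ⟨i + 1, by rw [Function.iterate_succ_apply', hi, hc]⟩
  have hdisj : ∀ i ∈ I, ∀ j ∈ I, i ≠ j → Disjoint (P i) (P j) := by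
    have hn : ∀ c, some c ∈ I → Disjoint (P none) (P (some c)) := by
      intro c hc
      rw [Finset.disjoint_left]
      intro w hw hw'
      simp only [P, Finset.mem_erase, Finset.mem_sdiff, Finset.mem_inter] at hw hw'
      exact hw.2.2 (hsubx c ((hIsome c).1 hc).1 w hw'.2.1)
    intro i hi j hj hij
    cases i with
    | none =>
      cases j with
      | none => exact absurd rfl hij
      | some c => exact hn c hj
    | some c =>
      cases j with
      | none => exact (hn c hi).symm
      | some c' =>
        rw [Finset.disjoint_left]
        intro w hw hw'
        simp only [P, Finset.mem_erase, Finset.mem_inter] at hw hw'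
        rw [hIsome] at hi hj
        exact hij (congrArg some
          (sub_disj par dep hdep hi.1 hi.2 hj.1 hj.2 hw.2.1 hw'.2.1))
  have hunion : I.biUnion P = O.erase z := by
    ext w
    simp only [Finset.mem_biUnion]
    constructor
    · rintro ⟨i, hi, hw⟩
      cases i with
      | none =>
        simp only [P, Finset.mem_erase, Finset.mem_sdiff] at hw
        exact Finset.mem_erase.2 ⟨hw.1, hw.2.1⟩
      | some c =>
        simp only [P, Finset.mem_erase, Finset.mem_inter] at hw
        exact Finset.mem_erase.2 ⟨hw.1, hw.2.2⟩
    · intro hw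
      rw [Finset.mem_erase] at hw
      by_cases hwx : w ∈ sub par x
      · have hne : w ≠ x := fun h => hw.1 (by rw [hzx (h ▸ hw.2), h])
        obtain ⟨c, hc1, hc2, hc3⟩ := sub_child par hwx hne
        exact ⟨some c, (hIsome c).2 ⟨hc1, hc2⟩, by simp [P, hw, hc3]⟩
      · exact ⟨none, by simp [I], by simp [P, hw, hwx]⟩
  have hclo : ∀ i ∈ I, Clo par (P i) (O.erase z) := by
    intro i hi u hu w hw hadj
    rw [Finset.mem_erase] at hw
    have hwx : w ≠ x := fun h => hw.1 (by rw [hzx (h ▸ hw.2), h])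
    cases i with
    | none =>
      simp only [P, Finset.mem_erase, Finset.mem_sdiff] at hu ⊢
      refine ⟨hw.1, hw.2, fun hws => hu.2.2 ?_⟩
      rcases hadj with h | h
      · exact sub_up par (h ▸ hws)
      · exact h ▸ sub_down par hws hwx
    | some c =>
      rw [hIsome] at hi
      simp only [P, Finset.mem_erase, Finset.mem_inter] at hu ⊢
      refine ⟨hw.1, ?_, hw.2⟩
      rcases hadj with h | h
      · have hne : u ≠ c := by
          rintro rfl
          exact hwx (h.symm.trans hi.1)
        exact h ▸ sub_down par hu.2.1 hne
      · exact sub_up par (h ▸ hu.2.1)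
  have hcardU : ∀ J ⊆ I, (J.biUnion P).card = ∑ i ∈ J, (P i).card := by
    intro J hJ
    exact Finset.card_biUnion (fun i hi j hj hij => hdisj i (hJ hi) j (hJ hj) hij)
  have hcloU : ∀ J ⊆ I, Clo par (J.biUnion P) (O.erase z) := by
    intro J hJ u hu w hw hadj
    rw [Finset.mem_biUnion] at *
    obtain ⟨i, hi, hui⟩ := hu
    exact ⟨i, hi, hclo i (hJ hi) u hui w hw hadj⟩
  have hsum : ∑ i ∈ I, (P i).card = O.card - 1 := by
    rw [← hcardU I (Finset.Subset.refl _), hunion, Finset.card_erase_of_mem hz]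
  obtain ⟨J1, J2, hJ, hJI, h3⟩ := numeric (fun i => (P i).card) a m s (a + (O.card - 1)) hs I
    (by rw [hsum]) (by omega) (by omega) none
    (by
      intro i hi hne
      cases i with
      | none => exact absurd rfl hne
      | some c =>
        rw [hIsome] at hi
        have hlt : (sub par c ∩ O).card < q := by
          by_contra hcon
          have h4 := hmax c (by omega)
          have h5 := hdep c (by rw [hi.1]; exact hi.2.symm)
          rw [hi.1] at h5
          omega
        have hle : (P (some c)).card ≤ (sub par c ∩ O).card :=
          Finset.card_le_card (Finset.erase_subset _ _)
        omega)
    (by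
      have hle : (P none).card ≤ (O \ sub par x).card :=
          Finset.card_le_card (Finset.erase_subset _ _)
      have h4 := Finset.card_sdiff_add_card_inter O (sub par x)
      rw [Finset.inter_comm] at h4
      omega)
  have hsub2 : J2.biUnion P ⊆ O.erase z := by
    rw [← hunion]; exact Finset.biUnion_subset_biUnion_of_subset_left _ hJI
  refine ⟨z, hz, J1.biUnion P, J2.biUnion P, Finset.biUnion_subset_biUnion_of_subset_left _ hJ,
    hsub2, hcloU _ (hJ.trans hJI), hcloU _ hJI, ?_⟩
  rw [hcardU _ (hJ.trans hJI), hcardU _ hJI]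
  exact h3

/-- The choice made at a root of a block of height `h + 1`, where `m` is the size of the two
blocks of height `h`. -/
lemma choose (hdep : ∀ u, par u ≠ u → dep (par u) < dep u) (r : V) (hr : ∀ u, u ∈ sub par r)
    (E A : Finset V) (m : ℕ) (hE : E.Nonempty) (hEc : E.card ≤ 4 * m + 2) (hAE : A ⊆ E)
    (hA : A.card ≤ 2 * m + 1) (hAc : Clo par A E) :
    ∃ x ∈ E, ∃ X1 X2 : Finset V, X1 ⊆ X2 ∧ X2 ⊆ E.erase x ∧ Clo par X1 (E.erase x) ∧
      Clo par X2 (E.erase x) ∧ A.erase x ⊆ X1 ∧ X1.card ≤ 2 * m ∧ X2.card ≤ 3 * m ∧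
      ((m ≤ X1.card ∧ 2 * m ≤ X2.card ∧ 2 * m + 1 ≤ E.card) ∨
        (X1 = E.erase x ∧ X2 = E.erase x)) := by
  have hself : ∀ S : Finset V, Clo par S S := fun S u _ w hw _ => hw
  by_cases hc : E.card ≤ 2 * m + 1
  · obtain ⟨x, hx⟩ := hE
    have := Finset.card_erase_of_mem hx
    refine ⟨x, hx, E.erase x, E.erase x, Finset.Subset.refl _, Finset.Subset.refl _, hself _,
      hself _, Finset.erase_subset_erase _ hAE, by omega, by omega, Or.inr ⟨rfl, rfl⟩⟩
  by_cases hA2 : A.card ≤ 2 * m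
  · have hO := Finset.card_sdiff_add_card_eq_card hAE
    obtain ⟨z, hz, X1, X2, h12, h2, hc1, hc2, hn⟩ := split par dep hdep r hr (E \ A) A.card m hA2
      (by omega) (by omega)
    rw [Finset.mem_sdiff] at hz
    have hd : ∀ X ⊆ (E \ A).erase z, (A ∪ X).card = A.card + X.card := by
      intro X hX
      refine Finset.card_union_of_disjoint ?_
      rw [Finset.disjoint_left]
      intro u hu hu'
      have := hX hu'
      simp only [Finset.mem_erase, Finset.mem_sdiff] at this
      exact this.2.2 hu
    have hcl : ∀ X ⊆ (E \ A).erase z, Clo par X ((E \ A).erase z) →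
        Clo par (A ∪ X) (E.erase z) := by
      intro X hX hXc u hu w hw hadj
      rw [Finset.mem_erase] at hw
      rw [Finset.mem_union] at hu ⊢
      rcases hu with hu | hu
      · exact Or.inl (hAc u hu w hw.2 hadj)
      · by_cases hwA : w ∈ A
        · exact Or.inl hwA
        · exact Or.inr (hXc u hu w (by simp [hw, hwA]) hadj)
    refine ⟨z, hz.1, A ∪ X1, A ∪ X2, Finset.union_subset_union_right h12, ?_,
      hcl X1 (h12.trans h2) hc1, hcl X2 h2 hc2,
      (Finset.erase_subset _ _).trans Finset.subset_union_left, ?_, ?_, Or.inl ⟨?_, ?_, by omega⟩⟩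
    · intro u hu
      rw [Finset.mem_union] at hu
      rcases hu with hu | hu
      · exact Finset.mem_erase.2 ⟨fun h => hz.2 (h ▸ hu), hAE hu⟩
      · have := h2 hu
        simp only [Finset.mem_erase, Finset.mem_sdiff] at this ⊢
        exact ⟨this.1, this.2.1⟩
    · rw [hd X1 (h12.trans h2)]; omega
    · rw [hd X2 h2]; omega
    · rw [hd X1 (h12.trans h2)]; omega
    · rw [hd X2 h2]; omega
  · obtain ⟨x, hx⟩ : A.Nonempty := by rw [← Finset.card_pos]; omega
    have := Finset.card_erase_of_mem hx
    have hcl : Clo par (A.erase x) (E.erase x) := by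
      intro u hu w hw hadj
      rw [Finset.mem_erase] at *
      exact ⟨hw.1, hAc u hu.2 w hw.2 hadj⟩
    exact ⟨x, hAE hx, A.erase x, A.erase x, Finset.Subset.refl _,
      Finset.erase_subset_erase _ hAE, hcl, hcl, Finset.Subset.refl _, by omega, by omega,
      Or.inl ⟨by omega, by omega, by omega⟩⟩


lemma fill (hdep : ∀ u, par u ≠ u → dep (par u) < dep u) (r : V) (hr : ∀ u, u ∈ sub par r)
    (h : ℕ) : ∀ (p : ℕ) (E : Finset V) (L : ℕ → Finset V), E.card ≤ 2 * Mh h →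
      L h ⊆ E → (∀ j k, j ≤ k → k ≤ h → L j ⊆ L k) → (∀ k ≤ h, (L k).card ≤ Mh k) →
      (∀ k ≤ h, Clo par (L k) E) →
      ∃ (D : Finset V) (g : V → ℕ) (L' : ℕ → Finset V),
        D ⊆ E ∧ D.card = min E.card (Mh h) ∧ Set.InjOn g D ∧
        (∀ d ∈ D, p ≤ g d ∧ g d < p + D.card) ∧
        (∀ u ∈ D, par u ∈ D → par u ≠ u →
          (g u, g (par u)) ∈ Ed h p ∨ (g (par u), g u) ∈ Ed h p) ∧
        (∀ k ≤ h, ∀ w ∈ L k, w ∈ D ∧ g w < p + (h - k) + Mh k) ∧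
        L' h = E \ D ∧ (∀ j k, j ≤ k → k ≤ h → L' j ⊆ L' k) ∧
        (∀ k ≤ h, (L' k).card ≤ Mh k) ∧ (∀ k ≤ h, Clo par (L' k) (E \ D)) ∧
        (∀ d ∈ D, ∀ w ∈ E \ D, (par d = w ∨ par w = d) →
          ∃ k, 1 ≤ k ∧ k ≤ h ∧ g d + Mh k = p + Mh h ∧ w ∈ L' k) := by
  have hself : ∀ S : Finset V, Clo par S S := fun S u _ w hw _ => hw
  induction h with
  | zero =>
    intro p E L hE hL _ hLc _
    have hE0 : E = ∅ := by simpa [Mh] using hE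
    subst hE0
    refine ⟨∅, fun _ => 0, fun _ => ∅, by simp, by simp, by simp, by simp, by simp, ?_, by simp,
      by simp, by simp, fun k _ => hself ∅, by simp⟩
    intro k hk w hw
    obtain rfl : k = 0 := by omega
    simpa using hL hw
  | succ h ih =>
    intro p E L hE hL hLm hLc hLcl
    have hMs : Mh (h + 1) = 2 * Mh h + 1 := rfl
    rcases E.eq_empty_or_nonempty with hE0 | hne
    · subst hE0
      have hL0 : ∀ k ≤ h + 1, ∀ w, w ∉ L k := by
        intro k hk w hw
        simpa using hL (hLm k (h + 1) hk le_rfl hw)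
      exact ⟨∅, fun _ => 0, fun _ => ∅, by simp, by simp, by simp, by simp, by simp,
        fun k hk w hw => absurd hw (hL0 k hk w), by simp,
        by simp, by simp, fun k _ => hself ∅, by simp⟩
    obtain ⟨x, hx, X1, X2, h12, h2E, hc1, hc2, hA, hX1, hX2, hsz⟩ :=
      choose par dep hdep r hr E (L (h + 1)) (Mh h) hne (by omega) hL
        (hMs ▸ hLc (h + 1) le_rfl) (hLcl (h + 1) le_rfl)
    have hEx := Finset.card_erase_of_mem hx
    have hEpos : 1 ≤ E.card := Finset.card_pos.2 hne
    have hLX : ∀ k ≤ h, (L k).erase x ⊆ X1 := fun k hk =>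
      (Finset.erase_subset_erase _ (hLm k (h + 1) (by omega) le_rfl)).trans hA
    obtain ⟨D1, g1, L1, hD1, hD1c, hg1, hr1, hed1, hl1, hL1h, hL1m, hL1c, hL1cl, hb1⟩ :=
      ih (p + 1) X1 (fun k => (L k).erase x) (by omega) (hLX h le_rfl)
        (fun j k hjk hk => Finset.erase_subset_erase _ (hLm j k hjk (by omega)))
        (fun k hk => (Finset.card_le_card (Finset.erase_subset _ _)).trans
          (hLc k (by omega)))
        (by
          intro k hk u hu w hw hadj
          have hw' := h2E (h12 hw)
          rw [Finset.mem_erase] at *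
          exact ⟨hw'.1, hLcl k (by omega) u hu.2 w hw'.2 hadj⟩)
    have hD1x : D1 ⊆ E.erase x := hD1.trans (h12.trans h2E)
    have hR1 := Finset.card_sdiff_add_card_eq_card hD1
    have hR2 := Finset.card_sdiff_add_card_eq_card (hD1.trans h12)
    have hX12 := Finset.card_le_card h12
    have hE2 : (X2 \ D1).card ≤ 2 * Mh h := by
      rcases hsz with hsz | hsz
      · omega
      · rw [hsz.1] at hX1 hR1 hD1c
        rw [hsz.2] at hR2 ⊢
        omega
    -- an edge leaving `D1` avoiding `x` stays in `X1`
    have hcl1 : ∀ u ∈ X1, ∀ w ∈ E, w ≠ x → (par u = w ∨ par w = u) → w ∈ X1 :=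
      fun u hu w hw hwx hadj => hc1 u hu w (Finset.mem_erase.2 ⟨hwx, hw⟩) hadj
    have hcl2 : ∀ u ∈ X2, ∀ w ∈ E, w ≠ x → (par u = w ∨ par w = u) → w ∈ X2 :=
      fun u hu w hw hwx hadj => hc2 u hu w (Finset.mem_erase.2 ⟨hwx, hw⟩) hadj
    have hL1X : ∀ k ≤ h, L1 k ⊆ X1 \ D1 := fun k hk => hL1h ▸ hL1m k h hk le_rfl
    obtain ⟨D2, g2, L2, hD2, hD2c, hg2, hr2, hed2, hl2, hL2h, hL2m, hL2c, hL2cl, hb2⟩ :=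
      ih (p + 1 + Mh h) (X2 \ D1) L1 hE2 (hL1h ▸ Finset.sdiff_subset_sdiff h12 (Finset.Subset.refl _))
        hL1m hL1c
        (by
          intro k hk u hu w hw hadj
          have hu1 := hL1X k hk hu
          rw [Finset.mem_sdiff] at hw hu1
          have hw' := Finset.mem_erase.1 (h2E hw.1)
          have := hcl1 u hu1.1 w hw'.2 hw'.1 hadj
          exact hL1cl k hk u hu w (Finset.mem_sdiff.2 ⟨this, hw.2⟩) hadj)
    have hD2X : ∀ d ∈ D2, d ∈ X2 ∧ d ∉ D1 := fun d hd => Finset.mem_sdiff.1 (hD2 hd)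
    have hR1D2 : ∀ w ∈ X1, w ∉ D1 → w ∈ D2 := fun w hw hw1 =>
      (hl2 h le_rfl w (hL1h ▸ Finset.mem_sdiff.2 ⟨hw, hw1⟩)).1
    have hx1 : x ∉ D1 := fun hh => (Finset.mem_erase.1 (hD1x hh)).1 rfl
    have hx2 : x ∉ D2 := fun hh => (Finset.mem_erase.1 (h2E (hD2X x hh).1)).1 rfl
    have hdj : Disjoint D1 D2 := by
      rw [Finset.disjoint_left]
      exact fun u hu hu' => (hD2X u hu').2 hu
    have hxU : x ∉ D1 ∪ D2 := by simp [hx1, hx2]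
    have hDc : (insert x (D1 ∪ D2)).card = D1.card + D2.card + 1 := by
      rw [Finset.card_insert_of_notMem hxU, Finset.card_union_of_disjoint hdj]
    have hDE : insert x (D1 ∪ D2) ⊆ E := by
      refine Finset.insert_subset hx (Finset.union_subset (hD1x.trans (Finset.erase_subset _ _)) ?_)
      exact fun d hd => (Finset.mem_erase.1 (h2E (hD2X d hd).1)).2
    have hDcard : (insert x (D1 ∪ D2)).card = min E.card (Mh (h + 1)) := by
      rw [hDc]
      rcases hsz with hsz | hsz
      · omega
      · rw [hsz.1] at hX1 hR1 hD1c
        rw [hsz.2] at hR2 hD2c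
        omega
    have hfull : D2.Nonempty → D1.card = Mh h := by
      intro hn
      have hpos := Finset.card_pos.2 hn
      rcases hsz with hsz | hsz
      · omega
      · rw [hsz.1] at hX1 hR1 hD1c
        rw [hsz.2] at hR2 hD2c
        omega
    let g : V → ℕ := fun u => if u = x then p else if u ∈ D1 then g1 u else g2 u
    have gx : g x = p := by simp [g]
    have gd1 : ∀ d ∈ D1, g d = g1 d := by
      intro d hd
      have : d ≠ x := fun hh => hx1 (hh ▸ hd)
      simp [g, this, hd]
    have gd2 : ∀ d ∈ D2, g d = g2 d := by
      intro d hd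
      have : d ≠ x := fun hh => hx2 (hh ▸ hd)
      simp [g, this, (hD2X d hd).2]
    have D1le : D1.card ≤ Mh h := by omega
    have D2le : D2.card ≤ Mh h := by omega
    have hmem : ∀ d, d ∈ insert x (D1 ∪ D2) ↔ d = x ∨ d ∈ D1 ∨ d ∈ D2 := by
      intro d; simp
    have hrange : ∀ d ∈ insert x (D1 ∪ D2),
        p ≤ g d ∧ g d < p + (insert x (D1 ∪ D2)).card := by
      intro d hd
      rw [hDc]
      rcases (hmem d).1 hd with rfl | hd | hd
      · rw [gx]; omega
      · have := hr1 d hd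
        rw [gd1 d hd]; omega
      · have := hr2 d hd
        have := hfull ⟨d, hd⟩
        rw [gd2 d hd]; omega
    -- the edges between the two halves
    have hcross : ∀ u ∈ D1, ∀ w ∈ D2, (par u = w ∨ par w = u) →
        (g u, g w) ∈ Ed (h + 1) p := by
      intro u hu w hw hadj
      have hwE := Finset.mem_erase.1 (h2E (hD2X w hw).1)
      have hwX := hcl1 u (hD1 hu) w hwE.2 hwE.1 hadj
      obtain ⟨k, hk1, hkh, hgk, hwk⟩ := hb1 u hu w (Finset.mem_sdiff.2 ⟨hwX, (hD2X w hw).2⟩) hadj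
      have h3 := (hl2 k hkh w hwk).2
      have h4 := (hr2 w hw).1
      rw [Ed]
      refine Finset.mem_union_right _ (Finset.mem_biUnion.2 ⟨k, Finset.mem_Icc.2 ⟨hk1, hkh⟩, ?_⟩)
      rw [Finset.mem_product, Finset.mem_singleton, Finset.mem_Ico, gd1 u hu, gd2 w hw]
      simp only
      omega
    have hroot : ∀ w, w ∈ D1 ∨ w ∈ D2 → (p, g w) ∈ Ed (h + 1) p := by
      intro w hw
      rw [Ed]
      refine Finset.mem_union_left _ (Finset.mem_union_left _ (Finset.mem_union_left _ ?_))
      rw [Finset.mem_product, Finset.mem_singleton, Finset.mem_Ioo]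
      refine ⟨rfl, ?_⟩
      show p < g w ∧ g w < p + Mh (h + 1)
      have hM2 : Mh (h + 1) = 2 * Mh h + 1 := rfl
      rw [hM2]
      clear hsz hDcard hfull hD1c hD2c
      rcases hw with hw | hw
      · have hh := hr1 w hw
        rw [gd1 w hw]
        exact ⟨by linarith [hh.1], by linarith [hh.2]⟩
      · have hh := hr2 w hw
        rw [gd2 w hw]
        exact ⟨by linarith [hh.1], by linarith [hh.2]⟩
    have hin1 : ∀ e ∈ Ed h (p + 1), e ∈ Ed (h + 1) p := by
      intro e he
      rw [Ed]
      exact Finset.mem_union_left _ (Finset.mem_union_left _ (Finset.mem_union_right _ he))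
    have hin2 : ∀ e ∈ Ed h (p + 1 + Mh h), e ∈ Ed (h + 1) p := by
      intro e he
      rw [Ed]
      exact Finset.mem_union_left _ (Finset.mem_union_right _ he)
    have hD2E2 : ∀ d ∈ D2, ∀ w ∈ E \ insert x (D1 ∪ D2), (par d = w ∨ par w = d) →
        w ∈ (X2 \ D1) \ D2 := by
      intro d hd w hw hadj
      rw [Finset.mem_sdiff, hmem] at hw
      push Not at hw
      have := hcl2 d (hD2X d hd).1 w hw.1 hw.2.1 hadj
      simp [this, hw.2.2.1, hw.2.2.2]
    have hEDsub : (X2 \ D1) \ D2 ⊆ E \ insert x (D1 ∪ D2) := by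
      intro w hw
      simp only [Finset.mem_sdiff] at hw
      have hwE := Finset.mem_erase.1 (h2E hw.1.1)
      rw [Finset.mem_sdiff, hmem]
      refine ⟨hwE.2, ?_⟩
      rintro (h3 | h3 | h3)
      · exact hwE.1 h3
      · exact hw.1.2 h3
      · exact hw.2 h3
    have hL2X : ∀ k ≤ h, L2 k ⊆ (X2 \ D1) \ D2 := fun k hk => hL2h ▸ hL2m k h hk le_rfl
    refine ⟨insert x (D1 ∪ D2), g, fun k => if k ≤ h then L2 k else E \ insert x (D1 ∪ D2), hDE,
      hDcard, ?_, hrange, ?_, ?_, by simp, ?_, ?_, ?_, ?_⟩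
    · -- injectivity
      intro u hu w hw huw
      rw [Finset.mem_coe, hmem] at hu hw
      rcases hu with rfl | hu | hu <;> rcases hw with rfl | hw | hw
      · rfl
      · have := hr1 w hw
        rw [gx, gd1 w hw] at huw; omega
      · have := hr2 w hw
        rw [gx, gd2 w hw] at huw; omega
      · have := hr1 u hu
        rw [gx, gd1 u hu] at huw; omega
      · rw [gd1 u hu, gd1 w hw] at huw
        exact hg1 hu hw huw
      · have := hr1 u hu
        have := hr2 w hw
        rw [gd1 u hu, gd2 w hw] at huw; omega
      · have := hr2 u hu
        rw [gx, gd2 u hu] at huw; omega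
      · have := hr2 u hu
        have := hr1 w hw
        rw [gd2 u hu, gd1 w hw] at huw; omega
      · rw [gd2 u hu, gd2 w hw] at huw
        exact hg2 hu hw huw
    · -- edges
      intro u hu hw hne'
      rw [hmem] at hu hw
      rcases hu with rfl | hu | hu
      · rcases hw with hw | hw
        · exact absurd hw hne'
        · left; rw [gx]; exact hroot _ hw
      · rcases hw with hw | hw | hw
        · right; rw [hw, gx]; exact hroot _ (Or.inl hu)
        · rw [gd1 u hu, gd1 _ hw]
          exact (hed1 u hu hw hne').imp (hin1 _) (hin1 _)
        · left; exact hcross u hu _ hw (Or.inl rfl)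
      · rcases hw with hw | hw | hw
        · right; rw [hw, gx]; exact hroot _ (Or.inr hu)
        · right; exact hcross _ hw u hu (Or.inr rfl)
        · rw [gd2 u hu, gd2 _ hw]
          exact (hed2 u hu hw hne').imp (hin2 _) (hin2 _)
    · -- urgent vertices
      intro k hk w hw
      have hwA := hLm k (h + 1) hk le_rfl hw
      have hMk := Mh_sub hk
      by_cases hwx : w = x
      · subst hwx
        refine ⟨Finset.mem_insert_self _ _, ?_⟩
        rw [gx]
        rcases Nat.eq_zero_or_pos k with rfl | hk0
        · omega
        · have := Mh_pos hk0; omega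
      · rcases Nat.lt_or_ge h k with hkh | hkh
        · obtain rfl : k = h + 1 := by omega
          have hwX := hA (Finset.mem_erase.2 ⟨hwx, hw⟩)
          have hwD : w ∈ insert x (D1 ∪ D2) := by
            rw [hmem]
            by_cases h3 : w ∈ D1
            · exact Or.inr (Or.inl h3)
            · exact Or.inr (Or.inr (hR1D2 w hwX h3))
          refine ⟨hwD, ?_⟩
          have := hrange w hwD
          omega
        · have h3 := hl1 k hkh w (Finset.mem_erase.2 ⟨hwx, hw⟩)
          refine ⟨(hmem w).2 (Or.inr (Or.inl h3.1)), ?_⟩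
          rw [gd1 w h3.1]
          have := h3.2
          omega
    · intro j k hjk hk
      simp only
      by_cases hkh : k ≤ h
      · rw [if_pos hkh, if_pos (hjk.trans hkh)]
        exact hL2m j k hjk hkh
      · rw [if_neg hkh]
        by_cases hjh : j ≤ h
        · rw [if_pos hjh]
          exact (hL2X j hjh).trans hEDsub
        · rw [if_neg hjh]
    · intro k hk
      simp only
      by_cases hkh : k ≤ h
      · rw [if_pos hkh]
        exact hL2c k hkh
      · rw [if_neg hkh]
        obtain rfl : k = h + 1 := by omega
        have := Finset.card_sdiff_add_card_eq_card hDE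
        omega
    · intro k hk
      simp only
      by_cases hkh : k ≤ h
      · rw [if_pos hkh]
        intro u hu w hw hadj
        have hu2 := hL2X k hkh hu
        have hw2 : w ∈ (X2 \ D1) \ D2 := by
          rw [Finset.mem_sdiff, hmem] at hw
          push Not at hw
          rw [Finset.mem_sdiff, Finset.mem_sdiff] at hu2
          have := hcl2 u hu2.1.1 w hw.1 hw.2.1 hadj
          simp [this, hw.2.2.1, hw.2.2.2]
        exact hL2cl k hkh u hu w hw2 hadj
      · rw [if_neg hkh]
        exact hself _
    · intro d hd w hw hadj
      rcases (hmem d).1 hd with rfl | hd | hd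
      · exact ⟨h + 1, by omega, le_rfl, by rw [gx], by simpa using hw⟩
      · exfalso
        have hw' := Finset.mem_sdiff.1 hw
        rw [hmem] at hw'
        push Not at hw'
        have hwX := hcl1 d (hD1 hd) w hw'.1 hw'.2.1 hadj
        exact hw'.2.2.2 (hR1D2 w hwX hw'.2.2.1)
      · obtain ⟨k, hk1, hkh, hgk, hwk⟩ := hb2 d hd w (hD2E2 d hd w hw hadj) hadj
        refine ⟨k, hk1, by omega, by rw [gd2 d hd]; omega, ?_⟩
        simp only
        rw [if_pos hkh]
        exact hwk
end

/-- Rooting a tree. -/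
lemma exists_root {V : Type} [Fintype V] [DecidableEq V] (T : SimpleGraph V) (hT : T.IsTree) :
    ∃ (par : V → V) (dep : V → ℕ) (r : V), (∀ u, par u ≠ u → dep (par u) < dep u) ∧
      (∀ u, u ∈ sub par r) ∧ ∀ u w, T.Adj u w → par u = w ∨ par w = u := by
  classical
  obtain ⟨r⟩ := hT.isConnected.nonempty
  choose P hP hPu using fun u => hT.existsUnique_path u r
  have hpar : ∀ u, u ≠ r → P (P u).snd = (P u).tail := by
    intro u hu
    exact (hPu _ _ (hP u).tail).symm
  have hlen : ∀ u, u ≠ r → (P (P u).snd).length + 1 = (P u).length := by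
    intro u hu
    rw [hpar u hu]
    exact SimpleGraph.Walk.length_tail_add_one (SimpleGraph.Walk.not_nil_of_ne hu)
  have hrr : (P r).snd = r := by
    have : P r = SimpleGraph.Walk.nil := (hPu r _ SimpleGraph.Walk.IsPath.nil).symm
    rw [this]; rfl
  refine ⟨fun u => (P u).snd, fun u => (P u).length, r, ?_, ?_, ?_⟩
  · intro u hu
    have hur : u ≠ r := by rintro rfl; exact hu hrr
    have := hlen u hur
    simp only
    omega
  · have : ∀ n u, (P u).length = n → u ∈ sub (fun u => (P u).snd) r := by
      intro n
      induction n with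
      | zero =>
        intro u hu
        have := SimpleGraph.Walk.eq_of_length_eq_zero hu
        subst this
        exact self_mem_sub _ _
      | succ n ih =>
        intro u hu
        by_cases hur : u = r
        · subst hur; exact self_mem_sub _ _
        · have := hlen u hur
          exact sub_up _ (ih _ (by omega))
    exact fun u => this _ u rfl
  · intro u w huw
    by_cases h : u ∈ (P w).support
    · right
      exact (hT.isAcyclic.eq_snd_of_adj_start (hP w) huw.symm h).symm
    · left
      have : P u = SimpleGraph.Walk.cons huw (P w) :=
        (hPu u _ ((SimpleGraph.Walk.cons_isPath_iff _ _).2 ⟨hP w, h⟩)).symm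
      simp only
      rw [this, SimpleGraph.Walk.snd_cons]

/-- There is a constant `C > 0` such that for every `n ≥ 1` there exists a graph on `n`
vertices with at most `(2/ln 2) n ln n + C n` edges that contains every tree on `n`
vertices as a subgraph. -/
theorem stmt_1 :
    ∃ C : ℝ, 0 < C ∧ ∀ n : ℕ, 1 ≤ n →
      ∃ U : SimpleGraph (Fin n),
        (U.edgeSet.ncard : ℝ) ≤ 2 / Real.log 2 * n * Real.log n + C * n ∧
        ∀ T : SimpleGraph (Fin n), T.IsTree → Contains U T := by
  refine ⟨5, by norm_num, fun n hn => ?_⟩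
  set H := Nat.log 2 n + 1 with hH
  have hnM : n ≤ Mh H := by
    have h1 := Nat.lt_pow_succ_log_self (b := 2) (by norm_num) n
    have h2 := Mh_eq H
    have h3 : 2 ^ H = 2 ^ (Nat.log 2 n).succ := rfl
    omega
  let U : SimpleGraph (Fin n) :=
    SimpleGraph.fromRel (fun a b => (a.val, b.val) ∈ Ed H 0)
  refine ⟨U, ?_, ?_⟩
  · have hcard : U.edgeSet.ncard ≤ 2 * H * n + 3 * n := by
      refine le_trans ?_ ((Ed_card H).1 0 n hnM)
      have hinj : Set.InjOn (Sym2.map (Fin.val : Fin n → ℕ)) U.edgeSet :=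
        (Sym2.map.injective Fin.val_injective).injOn
      rw [← Set.ncard_image_of_injOn hinj]
      have hsub : Set.image (Sym2.map (Fin.val : Fin n → ℕ)) U.edgeSet ⊆
          (((Ed H 0).filter (fun e => e.2 < 0 + n)).image (fun e => s(e.1, e.2)) :
            Finset (Sym2 ℕ)) := by
        rintro _ ⟨e, he, rfl⟩
        induction e using Sym2.ind with
        | _ a b =>
          rw [SimpleGraph.mem_edgeSet, SimpleGraph.fromRel_adj] at he
          simp only [Finset.coe_image, Set.mem_image, Finset.mem_coe, Finset.mem_filter]
          rcases he.2 with h | h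
          · exact ⟨(a.val, b.val), ⟨h, by simp⟩, by simp⟩
          · exact ⟨(b.val, a.val), ⟨h, by simp⟩, by simp [Sym2.eq_swap]⟩
      refine le_trans (Set.ncard_le_ncard hsub (Finset.finite_toSet _)) ?_
      rw [Set.ncard_coe_finset]
      exact Finset.card_image_le
    have hlog2 : 0 < Real.log 2 := Real.log_pos (by norm_num)
    have hHle : (Nat.log 2 n : ℝ) ≤ Real.log n / Real.log 2 := by
      rw [le_div_iff₀ hlog2]
      have h1 : (2 : ℝ) ^ (Nat.log 2 n) ≤ n := by
        exact_mod_cast Nat.pow_log_le_self 2 (by omega)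
      have h2 := Real.log_le_log (by positivity) h1
      rwa [Real.log_pow] at h2
    have hc : (U.edgeSet.ncard : ℝ) ≤ 2 * (Nat.log 2 n + 1) * n + 3 * n := by
      have : ((U.edgeSet.ncard : ℕ) : ℝ) ≤ ((2 * H * n + 3 * n : ℕ) : ℝ) := by exact_mod_cast hcard
      rw [hH] at this
      push_cast at this
      exact this
    have hn0 : (0 : ℝ) ≤ n := by positivity
    have e : 2 / Real.log 2 * n * Real.log n = 2 * (Real.log n / Real.log 2) * n := by ring
    rw [e]
    nlinarith
  · intro T hT
    obtain ⟨par, dep, r, hdep, hr, hadj⟩ := exists_root T hT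
    obtain ⟨D, g, L', hD, hDc, hinj, hrange, hed, -⟩ := fill par dep hdep r hr H 0 Finset.univ
      (fun _ => ∅) (by simp; omega) (by simp) (by simp) (by simp)
      (fun k _ u hu => by simp at hu)
    have hDn : D.card = n := by rw [hDc]; simp; omega
    have hDu : D = Finset.univ := by
      rw [← Finset.card_eq_iff_eq_univ, hDn]; simp
    have hall : ∀ u, u ∈ D := by intro u; rw [hDu]; simp
    have hlt : ∀ u, g u < n := by
      intro u
      have := (hrange u (hall u)).2
      omega
    refine ⟨fun u => ⟨g u, hlt u⟩, ?_, ?_⟩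
    · intro u w huw
      exact hinj (hall u) (hall w) (by simpa using huw)
    · intro u w huw
      have hne := huw.ne
      have hgne : (⟨g u, hlt u⟩ : Fin n) ≠ ⟨g w, hlt w⟩ := by
        intro h
        exact hne (hinj (hall u) (hall w) (by simpa using h))
      rw [SimpleGraph.fromRel_adj]
      refine ⟨hgne, ?_⟩
      rcases hadj u w huw with h | h
      · subst h
        exact hed u (hall u) (hall _) hne.symm
      · subst h
        exact (hed w (hall w) (hall _) hne).symm
end

section
/- There exists a constant C > 0 such that for all integers n ≥ 1 and w ≥ 1 with w < n, every simple graph U on n vertices that contains every graph with at most n vertices and treewidth at most w as a subgraph (up to isomorphism) has at least n·w·ln(n/w) − C·n·w edges. Consequently, s_w(n) ≥ n·w·ln(n/w) − O(n·w) uniformly in w. -/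
/-- `(T, B)` is a tree-decomposition of the graph `G`: `T` is a (finite) tree, every
vertex of `G` lies in some bag, every edge of `G` has both endpoints in a common bag,
and for each vertex of `G` the set of tree-vertices whose bag contains it induces a
connected subgraph (subtree) of `T`. -/
def IsTreeDecomp {V ι : Type} (G : SimpleGraph V) (T : SimpleGraph ι)
    (B : ι → Finset V) : Prop :=
  T.IsTree ∧
  (∀ v : V, ∃ x : ι, v ∈ B x) ∧
  (∀ u v : V, G.Adj u v → ∃ x : ι, u ∈ B x ∧ v ∈ B x) ∧
  (∀ v : V, (T.induce {x : ι | v ∈ B x}).Connected)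

/-- The treewidth of `G` is at most `w`: there is a tree-decomposition all of whose
bags have size at most `w + 1`. -/
def TreewidthLE {V : Type} (G : SimpleGraph V) (w : ℕ) : Prop :=
  ∃ (ι : Type) (_ : Fintype ι) (T : SimpleGraph ι) (B : ι → Finset V),
    IsTreeDecomp G T B ∧ ∀ x : ι, (B x).card ≤ w + 1

/-- Parent map of the depth-two tree. -/
def kwPar {k p : ℕ} : Option (Fin k × Option (Fin p)) → Option (Fin k × Option (Fin p))
  | none => none
  | some (_, none) => none
  | some (i, some _) => some (i, none)

/-- The depth-two tree. -/
def kwTree (k p : ℕ) : SimpleGraph (Option (Fin k × Option (Fin p))) :=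
  SimpleGraph.fromRel (fun x y => y = kwPar x)

lemma kwTree_adj_par {k p : ℕ} (x : Option (Fin k × Option (Fin p))) (hx : x ≠ none) :
    (kwTree k p).Adj x (kwPar x) := by
  rw [kwTree, SimpleGraph.fromRel_adj]
  refine ⟨?_, Or.inl rfl⟩
  rcases x with _ | ⟨i, _ | l⟩ <;> simp_all [kwPar]

lemma kwTree_connected (k p : ℕ) : (kwTree k p).Connected := by
  rw [SimpleGraph.connected_iff_exists_forall_reachable]
  refine ⟨none, ?_⟩
  have h1 : ∀ i : Fin k, (kwTree k p).Reachable none (some (i, none)) := fun i =>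
    (kwTree_adj_par (some (i, none)) (by simp)).symm.reachable
  rintro (_ | ⟨i, _ | l⟩)
  · exact SimpleGraph.Reachable.refl _
  · exact h1 i
  · exact (h1 i).trans (kwTree_adj_par (some (i, some l)) (by simp)).symm.reachable

lemma kwTree_isTree (k p : ℕ) : (kwTree k p).IsTree := by
  classical
  rw [SimpleGraph.isTree_iff_connected_and_card]
  refine ⟨kwTree_connected k p, le_antisymm ?_
    (kwTree_connected k p).card_vert_le_card_edgeSet_add_one⟩
  have hsub : (kwTree k p).edgeSet ⊆
      (fun x : Fin k × Option (Fin p) => s(some x, kwPar (some x))) '' Set.univ := by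
    intro e he
    induction e using Sym2.ind with
    | _ x y =>
      rw [SimpleGraph.mem_edgeSet, kwTree, SimpleGraph.fromRel_adj] at he
      obtain ⟨hne, h | h⟩ := he
      · rcases x with _ | x
        · exact absurd h.symm hne
        · exact ⟨x, trivial, by simp [h]⟩
      · rcases y with _ | y
        · exact absurd h hne
        · refine ⟨y, trivial, ?_⟩
          simp only [h]
          exact Sym2.eq_swap
  have h1 := Set.ncard_le_ncard hsub (Set.toFinite _)
  have h2 := Set.ncard_image_le (f := fun x : Fin k × Option (Fin p) => s(some x, kwPar (some x)))
    (s := Set.univ) (Set.toFinite _)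
  rw [Set.ncard_univ] at h2
  have h3 : Nat.card (Option (Fin k × Option (Fin p))) = Nat.card (Fin k × Option (Fin p)) + 1 := by
    simp [Nat.card_eq_fintype_card]
  rw [h3]
  have h4 : Nat.card (kwTree k p).edgeSet = (kwTree k p).edgeSet.ncard := rfl
  omega

/-- `k` disjoint copies of `K_{w,p}`. -/
def kwGraph (k w p : ℕ) : SimpleGraph (Fin k × (Fin w ⊕ Fin p)) where
  Adj x y := x.1 = y.1 ∧ ((x.2.isLeft ∧ y.2.isRight) ∨ (x.2.isRight ∧ y.2.isLeft))
  symm := ⟨by rintro x y ⟨h, h'⟩; exact ⟨h.symm, by tauto⟩⟩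
  loopless := ⟨by rintro ⟨i, a | b⟩ <;> simp⟩

/-- bags -/
def kwBag (k w p : ℕ) : Option (Fin k × Option (Fin p)) → Finset (Fin k × (Fin w ⊕ Fin p))
  | none => ∅
  | some (i, none) => Finset.univ.image (fun a : Fin w => (i, Sum.inl a))
  | some (i, some l) => insert (i, Sum.inr l) (Finset.univ.image (fun a : Fin w => (i, Sum.inl a)))

lemma kwBag_card (k w p : ℕ) (x) : (kwBag k w p x).card ≤ w + 1 := by
  have h : ∀ i : Fin k, (Finset.univ.image
      (fun a : Fin w => ((i, Sum.inl a) : Fin k × (Fin w ⊕ Fin p)))).card ≤ w := fun i =>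
    Finset.card_image_le.trans (by simp)
  rcases x with _ | ⟨i, _ | l⟩
  · simp [kwBag]
  · exact (h i).trans (by omega)
  · exact (Finset.card_insert_le _ _).trans (by have := h i; omega)

lemma kwGraph_decomp (k w p : ℕ) : IsTreeDecomp (kwGraph k w p) (kwTree k p) (kwBag k w p) := by
  refine ⟨kwTree_isTree k p, ?_, ?_, ?_⟩
  · rintro ⟨i, a | l⟩
    · exact ⟨some (i, none), by simp [kwBag]⟩
    · exact ⟨some (i, some l), by simp [kwBag]⟩
  · rintro ⟨i, a | l⟩ ⟨i', a' | l'⟩ ⟨h, h'⟩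
    · simp at h'
    · simp only at h; subst h
      exact ⟨some (i, some l'), by simp [kwBag]⟩
    · simp only at h; subst h
      exact ⟨some (i, some l), by simp [kwBag]⟩
    · simp at h'
  · rintro ⟨i, a | l⟩
    · rw [SimpleGraph.connected_iff_exists_forall_reachable]
      refine ⟨⟨some (i, none), by simp [kwBag]⟩, ?_⟩
      rintro ⟨_ | ⟨j, _ | l⟩, hx⟩
      · simp [kwBag] at hx
      · have : i = j := by simpa [kwBag, eq_comm] using hx
        subst this
        exact SimpleGraph.Reachable.refl _
      · have : i = j := by simpa [kwBag, eq_comm] using hx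
        subst this
        apply SimpleGraph.Adj.reachable
        exact (kwTree_adj_par (some (i, some l)) (by simp)).symm
    · rw [SimpleGraph.connected_iff_exists_forall_reachable]
      refine ⟨⟨some (i, some l), by simp [kwBag]⟩, ?_⟩
      rintro ⟨_ | ⟨j, _ | l'⟩, hx⟩
      · simp [kwBag] at hx
      · simp [kwBag] at hx
      · have : i = j ∧ l = l' := by simpa [kwBag, eq_comm] using hx
        obtain ⟨rfl, rfl⟩ := this
        exact SimpleGraph.Reachable.refl _

lemma treewidthLE_comap {V W : Type} [DecidableEq V] [DecidableEq W] (e : V ≃ W)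
    (G : SimpleGraph W) (w : ℕ)
    (h : TreewidthLE G w) : TreewidthLE (G.comap e) w := by
  obtain ⟨ι, hι, T, B, ⟨h1, h2, h3, h4⟩, h5⟩ := h
  have key : ∀ x v, v ∈ (B x).map e.symm.toEmbedding ↔ e v ∈ B x := by
    intro x v
    rw [Finset.mem_map_equiv]; simp
  refine ⟨ι, hι, T, fun x => (B x).map e.symm.toEmbedding, ⟨h1, ?_, ?_, ?_⟩, ?_⟩
  · intro v; simpa only [key] using h2 (e v)
  · intro u v huv; simpa only [key] using h3 _ _ huv
  · intro v
    have hset : {x | v ∈ (B x).map e.symm.toEmbedding} = {x | e v ∈ B x} := by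
      ext x; exact key x v
    rw [hset]
    exact h4 (e v)
  · intro x; simpa using h5 x

/-- edges touching a set -/
def touchSet {n : ℕ} (U : SimpleGraph (Fin n)) (A : Finset (Fin n)) : Set (Sym2 (Fin n)) :=
  {e | e ∈ U.edgeSet ∧ ∃ a ∈ A, a ∈ e}

lemma greedy_step {n w j k p : ℕ} (hjk : j < k * w) (U : SimpleGraph (Fin n))
    (f : Fin k × (Fin w ⊕ Fin p) → Fin n) (hf : Function.Injective f)
    (hadj : ∀ u v, (kwGraph k w p).Adj u v → U.Adj (f u) (f v))
    (A : Finset (Fin n)) (hA : A.card = j) :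
    ∃ v, v ∉ A ∧ (touchSet U A).ncard + (p - w) ≤ (touchSet U (insert v A)).ncard := by
  classical
  have hw : 0 < w := by
    rcases Nat.eq_zero_or_pos w with h | h
    · subst h; simp at hjk
    · exact h
  -- loss
  let loss : Fin k → ℕ := fun i => (Finset.univ.filter (fun l : Fin p => f (i, Sum.inr l) ∈ A)).card
  have hex : ∃ c : Fin k × Fin w, f (c.1, Sum.inl c.2) ∉ A ∧ loss c.1 ≤ w := by
    by_contra hcon
    push Not at hcon
    let P : Finset (Fin k × Fin w) := Finset.univ.filter (fun c => f (c.1, Sum.inl c.2) ∉ A)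
    let P' : Finset (Fin k × Fin w) := Finset.univ.filter (fun c => f (c.1, Sum.inl c.2) ∈ A)
    let Q : Finset (Fin k × Fin p) := Finset.univ.filter (fun c => f (c.1, Sum.inr c.2) ∈ A)
    have hPP : P'.card + P.card = k * w := by
      have := Finset.card_filter_add_card_filter_not (s := (Finset.univ : Finset (Fin k × Fin w)))
        (fun c => f (c.1, Sum.inl c.2) ∈ A)
      simpa using this
    have hQ : Q.card = ∑ i, loss i := by
      simp only [Q, loss, Finset.card_filter]
      rw [Fintype.sum_prod_type]
    have h1 : P.card * w ≤ ∑ c ∈ P, loss c.1 := by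
      rw [← smul_eq_mul]
      apply Finset.card_nsmul_le_sum
      intro c hc
      exact (hcon c (by simpa [P] using hc)).le
    have h2 : ∑ c ∈ P, loss c.1 ≤ ∑ c : Fin k × Fin w, loss c.1 :=
      Finset.sum_le_sum_of_subset (Finset.subset_univ _)
    have h3 : ∑ c : Fin k × Fin w, loss c.1 = Q.card * w := by
      rw [Fintype.sum_prod_type, hQ, Finset.sum_mul]
      simp [mul_comm]
    have h4 : P.card ≤ Q.card := Nat.le_of_mul_le_mul_right (h1.trans (h2.trans h3.le)) hw
    have h5 : P'.card + Q.card ≤ A.card := by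
      have e1 : (P'.image (fun c => f (c.1, Sum.inl c.2))).card = P'.card := by
        apply Finset.card_image_of_injective
        intro c d h
        have := hf h
        simp only [Prod.mk.injEq, Sum.inl.injEq] at this
        exact Prod.ext this.1 this.2
      have e2 : (Q.image (fun c => f (c.1, Sum.inr c.2))).card = Q.card := by
        apply Finset.card_image_of_injective
        intro c d h
        have := hf h
        simp only [Prod.mk.injEq, Sum.inr.injEq] at this
        exact Prod.ext this.1 this.2
      rw [← e1, ← e2, ← Finset.card_union_of_disjoint]
      · apply Finset.card_le_card
        intro x hx
        simp only [P', Q, Finset.mem_union, Finset.mem_image, Finset.mem_filter] at hx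
        rcases hx with ⟨c, hc, rfl⟩ | ⟨c, hc, rfl⟩ <;> exact hc.2
      · rw [Finset.disjoint_left]
        intro x hx hx'
        simp only [Finset.mem_image] at hx hx'
        obtain ⟨c, _, rfl⟩ := hx
        obtain ⟨d, _, h⟩ := hx'
        have := hf h
        simp at this
    omega
  obtain ⟨⟨i, a⟩, hc, hl⟩ := hex
  simp only at hc hl
  refine ⟨f (i, Sum.inl a), hc, ?_⟩
  let R : Finset (Fin p) := Finset.univ.filter (fun l : Fin p => f (i, Sum.inr l) ∉ A)
  have hR : loss i + R.card = p := by
    have := Finset.card_filter_add_card_filter_not (s := (Finset.univ : Finset (Fin p)))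
        (fun l => f (i, Sum.inr l) ∈ A)
    simpa using this
  let g : Fin p → Sym2 (Fin n) := fun l => s(f (i, Sum.inl a), f (i, Sum.inr l))
  have hg : Function.Injective g := by
    intro l l' h
    simp only [g, Sym2.congr_right] at h
    simpa using hf h
  have hn : (g '' (R : Set (Fin p))).ncard = R.card := by
    rw [Set.ncard_image_of_injective _ hg, Set.ncard_coe_finset]
  have hdis : Disjoint (touchSet U A) (g '' (R : Set (Fin p))) := by
    rw [Set.disjoint_left]
    rintro e ⟨_, b, hb, hbe⟩ ⟨l, hl', rfl⟩
    simp only [g, Sym2.mem_iff] at hbe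
    rcases hbe with rfl | rfl
    · exact hc hb
    · simp [R] at hl'; exact hl' hb
  have hsub : touchSet U A ∪ g '' (R : Set (Fin p)) ⊆ touchSet U (insert (f (i, Sum.inl a)) A) := by
    rintro e (⟨he, b, hb, hbe⟩ | ⟨l, _, rfl⟩)
    · exact ⟨he, b, Finset.mem_insert_of_mem hb, hbe⟩
    · refine ⟨?_, _, Finset.mem_insert_self _ _, Sym2.mem_mk_left _ _⟩
      exact hadj _ _ ⟨rfl, by simp⟩
  have h6 := Set.ncard_le_ncard hsub (Set.toFinite _)
  rw [Set.ncard_union_eq hdis (Set.toFinite _) (Set.toFinite _), hn] at h6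
  omega

lemma greedy_s2 {n w : ℕ} (hw : 1 ≤ w) (U : SimpleGraph (Fin n))
    (hU : ∀ (m : ℕ) (H : SimpleGraph (Fin m)), m ≤ n → TreewidthLE H w → Contains U H)
    (j : ℕ) (hj : j ≤ (n / w) * w) :
    ∃ A : Finset (Fin n), A.card = j ∧
      ∑ i ∈ Finset.range j, (n / (i / w + 1) - 2 * w) ≤ (touchSet U A).ncard := by
  classical
  induction j with
  | zero => exact ⟨∅, by simp⟩
  | succ j ih =>
    obtain ⟨A, hA, hs⟩ := ih (by omega)
    have hk : j / w + 1 ≤ n / w := by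
      have : j / w < n / w := by rw [Nat.div_lt_iff_lt_mul (by omega)]; omega
      omega
    have hkw : w ≤ n / (j / w + 1) := by
      rw [Nat.le_div_iff_mul_le (Nat.succ_pos _)]
      calc w * (j / w + 1) ≤ w * (n / w) := Nat.mul_le_mul_left _ hk
        _ ≤ n := Nat.mul_div_le n w
    have hjk : j < (j / w + 1) * w := by
      rw [← Nat.div_lt_iff_lt_mul (by omega)]; exact Nat.lt_succ_self _
    set k := j / w + 1 with hkdef
    obtain ⟨p, hp⟩ : ∃ p, n / k = w + p := ⟨n / k - w, by omega⟩
    have hm : k * (w + p) ≤ n := by rw [← hp]; exact Nat.mul_div_le n k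
    let e : Fin (k * (w + p)) ≃ Fin k × (Fin w ⊕ Fin p) :=
      Fintype.equivOfCardEq (by simp)
    obtain ⟨f, hf, hadj⟩ := hU _ ((kwGraph k w p).comap e) hm
      (treewidthLE_comap e _ _ ⟨_, inferInstance, _, _, kwGraph_decomp k w p, kwBag_card k w p⟩)
    obtain ⟨v, hv, hle⟩ := greedy_step hjk U (f ∘ e.symm) (hf.comp e.symm.injective)
      (fun u v huv => hadj _ _ (by simpa using huv)) A hA
    refine ⟨insert v A, by rw [Finset.card_insert_of_notMem hv, hA], ?_⟩
    rw [Finset.sum_range_succ, ← hkdef, hp]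
    omega

lemma sum_blocks (w K : ℕ) (hw : 1 ≤ w) (h : ℕ → ℕ) :
    ∑ i ∈ Finset.range (K * w), h (i / w) = w * ∑ k ∈ Finset.range K, h k := by
  induction K with
  | zero => simp
  | succ K ih =>
    rw [Nat.succ_mul, Finset.sum_range_add, ih, Finset.sum_range_succ, mul_add]
    congr 1
    rw [Finset.sum_congr rfl (g := fun _ => h K)]
    · simp
    · intro x hx
      rw [Finset.mem_range] at hx
      rw [mul_comm K w, Nat.mul_add_div (by omega), Nat.div_eq_of_lt hx, add_zero]

/-- Lower bound: there is a constant `C > 0` such that for all `1 ≤ w < n`, every graph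
on `n` vertices that contains every graph with at most `n` vertices and treewidth at
most `w` as a subgraph has at least `n w ln(n/w) - C n w` edges. -/
theorem stmt_2 :
    ∃ C : ℝ, 0 < C ∧ ∀ n w : ℕ, 1 ≤ w → w < n →
      ∀ U : SimpleGraph (Fin n),
        (∀ (m : ℕ) (H : SimpleGraph (Fin m)), m ≤ n → TreewidthLE H w →
          Contains U H) →
        (n : ℝ) * w * Real.log ((n : ℝ) / (w : ℝ)) - C * n * w ≤
          (U.edgeSet.ncard : ℝ) := by
  refine ⟨3, by norm_num, ?_⟩
  intro n w hw hwn U hU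
  obtain ⟨A, -, hs⟩ := greedy_s2 hw U hU _ le_rfl
  have hle : (touchSet U A).ncard ≤ U.edgeSet.ncard :=
    Set.ncard_le_ncard (fun e he => he.1) (Set.toFinite _)
  have hs' := hs.trans hle
  rw [sum_blocks w (n / w) hw (fun k => n / (k + 1) - 2 * w)] at hs'
  set K := n / w with hK
  have hwpos : (0 : ℝ) < w := by exact_mod_cast hw
  have hnpos : (0 : ℝ) < n := by exact_mod_cast (by omega : 0 < n)
  have h1 : (w : ℝ) * ∑ k ∈ Finset.range K, ((n : ℝ) * ((k + 1 : ℕ) : ℝ)⁻¹ - (1 + 2 * w))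
      ≤ (U.edgeSet.ncard : ℝ) := by
    refine le_trans ?_ (Nat.cast_le.mpr hs')
    push_cast
    gcongr with k hk
    have h2 : (n : ℝ) / ((k + 1 : ℕ) : ℝ) ≤ (n / (k + 1) : ℕ) + 1 := by
      rw [div_le_iff₀ (by positivity)]
      have := Nat.lt_div_mul_add (a := n) (b := k + 1) (by omega)
      exact_mod_cast (by linarith : n ≤ (n / (k + 1) + 1) * (k + 1))
    have h3 : ((n / (k + 1) : ℕ) : ℝ) ≤ ((n / (k + 1) - 2 * w : ℕ) : ℝ) + 2 * w := by
      exact_mod_cast (by omega : n / (k + 1) ≤ (n / (k + 1) - 2 * w) + 2 * w)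
    rw [div_eq_mul_inv] at h2
    push_cast at h2
    linarith
  rw [Finset.sum_sub_distrib, ← Finset.mul_sum] at h1
  simp only [Finset.sum_const, Finset.card_range, nsmul_eq_mul] at h1
  have hh : Real.log ((n : ℝ) / w) ≤ ∑ k ∈ Finset.range K, (((k + 1 : ℕ) : ℝ))⁻¹ := by
    have h4 := log_add_one_le_harmonic K
    have h5 : ((harmonic K : ℚ) : ℝ) = ∑ k ∈ Finset.range K, (((k + 1 : ℕ) : ℝ))⁻¹ := by
      simp [harmonic]
    rw [h5] at h4
    refine le_trans (Real.log_le_log (by positivity) ?_) h4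
    rw [div_le_iff₀ hwpos]
    have := Nat.lt_div_mul_add (a := n) (b := w) (by omega)
    exact_mod_cast (by rw [← hK] at this; linarith : n ≤ (K + 1) * w)
  have hKw : (w : ℝ) * K ≤ n := by exact_mod_cast Nat.mul_div_le n w
  have h6 := mul_le_mul_of_nonneg_left hh (mul_pos hnpos hwpos).le
  have hw1 : (1 : ℝ) ≤ w := by exact_mod_cast hw
  have h7 : (w : ℝ) * K * (1 + 2 * w) ≤ n * (3 * w) := by
    gcongr
    linarith
  nlinarith [h1, h6, h7]
end
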